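/- Let A be a σ-finite AW*-algebra. Then A is A-injective: for every closed right ideal I of A and every bounded right A-module map f : I → A there exists c ∈ A such that f(x) = cx for all x ∈ I. -/

import Mathlib

variable {A : Type*} [CStarAlgebra A]

/-- A submodule `J ⊆ A` is a right ideal if it is closed under right multiplication
by arbitrary elements of `A`. -/
def IsRightIdeal (J : Submodule ℂ A) : Prop :=
  ∀ x ∈ J, ∀ a : A, x * a ∈ J

/-- A unital C*-algebra is an AW*-algebra if the right annihilator of every subset is
generated, as a right ideal, by a projection. -/
def IsAWStar (A : Type*) [CStarAlgebra A] : Prop :=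
  ∀ S : Set A, ∃ p : A, star p = p ∧ p * p = p ∧
    ∀ a : A, (∀ s ∈ S, s * a = 0) ↔ ∃ b : A, a = p * b

/-- An algebra is σ-finite if every family of pairwise orthogonal nonzero projections
is countable. -/
def SigmaFiniteAlg (A : Type*) [CStarAlgebra A] : Prop :=
  ∀ P : Set A, (∀ p ∈ P, star p = p ∧ p * p = p ∧ p ≠ 0) →
    (∀ p ∈ P, ∀ q ∈ P, p ≠ q → p * q = 0) → P.Countable

theorem IsAWStar.exists_support (hAW : IsAWStar A) (S : Set A) :
    ∃ e : A, IsStarProjection e ∧ (∀ s ∈ S, s * e = s) ∧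
      ∀ a : A, (∀ s ∈ S, s * a = 0) → e * a = 0 := by
  obtain ⟨p, hp, hpp, h⟩ := hAW S
  have hp' : IsStarProjection p := ⟨hpp, hp⟩
  refine ⟨1 - p, hp'.one_sub, fun s hs => ?_, fun a ha => ?_⟩
  · rw [mul_sub, mul_one, (h p).2 ⟨p, hpp.symm⟩ s hs, sub_zero]
  · obtain ⟨b, rfl⟩ := (h a).1 ha
    rw [sub_mul, one_mul, ← mul_assoc, hpp, sub_self]

theorem IsStarProjection.commute_of_corner_eq_zero {e a : A} (he : IsStarProjection e)
    (h₁ : e * a * (1 - e) = 0) (h₂ : e * star a * (1 - e) = 0) : a * e = e * a := by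
  have h₃ := congrArg star h₂
  simp only [star_mul, star_sub, star_one, star_star, star_zero, he.isSelfAdjoint.star_eq] at h₃
  have h₄ : e * a = e * a * e := by
    rw [mul_sub, mul_one, sub_eq_zero] at h₁; exact h₁
  have h₅ : a * e = e * a * e := by
    rw [sub_mul, one_mul, sub_eq_zero] at h₃; rw [h₃, mul_assoc]
  rw [h₄, ← h₅]

/-- An element that commutes with a self-adjoint set commutes with the support of the set. -/
theorem IsStarProjection.commute_support {S : Set A} {e a : A} (he : IsStarProjection e)
    (h₁ : ∀ s ∈ S, s * e = s) (h₂ : ∀ a : A, (∀ s ∈ S, s * a = 0) → e * a = 0)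
    (ha : ∀ s ∈ S, s * a = a * s) (ha' : ∀ s ∈ S, s * star a = star a * s) :
    a * e = e * a := by
  apply he.commute_of_corner_eq_zero
  · rw [mul_assoc]
    refine h₂ _ fun s hs => ?_
    rw [← mul_assoc, ha s hs, mul_assoc, mul_sub, mul_one, h₁ s hs, sub_self, mul_zero]
  · rw [mul_assoc]
    refine h₂ _ fun s hs => ?_
    rw [← mul_assoc, ha' s hs, mul_assoc, mul_sub, mul_one, h₁ s hs, sub_self, mul_zero]

theorem IsAWStar.exists_spectral_projection (hAW : IsAWStar A) (y : A) (hy : star y * y ≠ 0) :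
    ∃ q b : A, IsStarProjection q ∧ q ≠ 0 ∧ star b = b ∧ b * (star y * y) = star y * y * b ∧
      b * (star y * y) * b * q = q ∧
      ∀ a : A, IsSelfAdjoint a → a * (star y * y) = star y * y * a → a * q = q * a := by
  set k := star y * y with hk
  have hsa : IsSelfAdjoint k := .star_mul_self y
  have hpos : ∀ x ∈ spectrum ℝ k, 0 ≤ x := spectrum_star_mul_self_nonneg
  set ε : ℝ := ‖k‖ / 2
  have hε : 0 < ε := by have := norm_pos_iff.2 hy; positivity
  set b := cfc (fun t : ℝ => 1 / √(max t ε)) k with hb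
  set φ := cfc (fun t : ℝ => max (t - ε) 0) k with hφ
  have hcb : ContinuousOn (fun t : ℝ => 1 / √(max t ε)) (spectrum ℝ k) := by
    refine ContinuousOn.div (by fun_prop) (by fun_prop) fun t _ => ?_
    have : 0 < max t ε := lt_max_of_lt_right hε
    positivity
  have hcφ : ContinuousOn (fun t : ℝ => max (t - ε) 0) (spectrum ℝ k) := by fun_prop
  have hφsa : IsSelfAdjoint φ := cfc_predicate _ _
  have hφ0 : φ ≠ 0 := by
    intro h0
    have h1 : cfc (fun t : ℝ => max (t - ε) 0) k = cfc (fun _ : ℝ => (0 : ℝ)) k := by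
      rw [← hφ, h0, cfc_const_zero]
    have h2 := eqOn_of_cfc_eq_cfc h1 hcφ (by fun_prop) hsa
    have h3 : ‖cfc (id : ℝ → ℝ) k‖ ≤ ε := by
      refine norm_cfc_le hε.le fun t ht => ?_
      have h4 := h2 ht
      have h5 := hpos t ht
      simp only at h4
      rw [id, Real.norm_of_nonneg h5]
      have := le_max_left (t - ε) 0
      linarith
    rw [cfc_id ℝ k] at h3
    have := norm_pos_iff.2 hy
    simp only [ε] at h3
    linarith
  have hcomm : Commute k b := (Commute.refl k).cfc_real _ |>.symm
  have hbkb : φ * (b * k * b) = φ := by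
    have h1 : b * k * b = cfc (fun t : ℝ => 1 / √(max t ε) * t * (1 / √(max t ε))) k := by
      rw [cfc_mul _ _ k (by fun_prop) hcb, cfc_mul _ _ k hcb (by fun_prop), cfc_id' ℝ k]
    rw [h1, hφ, ← cfc_mul _ _ k hcφ (by fun_prop)]
    refine cfc_congr fun t ht => ?_
    have hm : 0 < max t ε := lt_max_of_lt_right hε
    have hs : √(max t ε) * √(max t ε) = max t ε := Real.mul_self_sqrt hm.le
    have hs0 : √(max t ε) ≠ 0 := by positivity
    have : 1 / √(max t ε) * t * (1 / √(max t ε)) = t / max t ε := by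
      rw [one_div, mul_right_comm, ← mul_inv, hs, inv_mul_eq_div]
    simp only [this]
    rcases le_total t ε with h | h
    · rw [max_eq_right (by linarith), zero_mul]
    · rw [max_eq_left h, div_self (by linarith), mul_one]
  obtain ⟨q, hq, hq1, hq2⟩ := hAW.exists_support {φ}
  have hbs : star b = b := (cfc_predicate (p := IsSelfAdjoint) _ k : IsSelfAdjoint b).star_eq
  refine ⟨q, b, hq, ?_, hbs, hcomm.eq.symm, ?_, ?_⟩
  · rintro rfl
    exact hφ0 (by simpa using (hq1 φ rfl).symm)
  · have h1 := hq2 (1 - b * k * b) (by simp [mul_sub, hbkb])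
    have h2 := congrArg star h1
    simp only [star_mul, star_sub, star_one, star_zero, hq.isSelfAdjoint.star_eq, hbs,
      hsa.star_eq, sub_mul, one_mul, sub_eq_zero] at h2
    conv_rhs => rw [h2]
    simp only [mul_assoc]
  · intro a hasa ha
    refine hq.commute_support hq1 hq2 ?_ ?_
    · rintro s rfl
      exact ((show Commute k a from ha.symm).cfc_real _).eq
    · rintro s rfl
      rw [hasa.star_eq]
      exact ((show Commute k a from ha.symm).cfc_real _).eq

/-- If the corner `p A q` is nonzero, then it contains a nonzero partial isometry. -/
theorem IsAWStar.exists_partial_isometry (hAW : IsAWStar A) {p q : A} (hp : IsStarProjection p)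
    (hq : IsStarProjection q) (x : A) (h : p * x * q ≠ 0) :
    ∃ v : A, v ≠ 0 ∧ IsStarProjection (star v * v) ∧ p * v = v ∧ v * q = v := by
  set y := p * x * q with hy
  have hyq : y * q = y := by rw [hy, mul_assoc, hq.isIdempotentElem]
  have hpy : p * y = y := by rw [hy, mul_assoc p, ← mul_assoc p, hp.isIdempotentElem]
  obtain ⟨e, b, he, he0, hb, hcom, hbe, -⟩ := hAW.exists_spectral_projection y
    (by rwa [Ne, CStarRing.star_mul_self_eq_zero_iff])
  have hv : star (y * b * e) * (y * b * e) = e := by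
    simp only [star_mul, hb, he.isSelfAdjoint.star_eq]
    calc e * (b * star y) * (y * b * e) = e * (b * (star y * y) * b * e) := by
          simp only [mul_assoc]
      _ = e := by rw [hbe, he.isIdempotentElem]
  have heq : e * q = e := by
    have h1 : q * e = e := by
      have hqk : q * (star y * y) = star y * y := by
        have := congrArg star hyq
        rw [star_mul, hq.isSelfAdjoint.star_eq] at this
        rw [← mul_assoc, this]
      conv_lhs => rw [← hbe, hcom]
      conv_rhs => rw [← hbe, hcom]
      simp only [← mul_assoc] at hqk ⊢
      rw [hqk]
    have := congrArg star h1
    rwa [star_mul, hq.isSelfAdjoint.star_eq, he.isSelfAdjoint.star_eq] at this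
  refine ⟨y * b * e, ?_, by rwa [hv], ?_, ?_⟩
  · intro h0
    rw [h0, mul_zero] at hv
    exact he0 hv.symm
  · simp only [← mul_assoc, hpy]
  · rw [mul_assoc, heq]

/-- A self-adjoint contraction is approximated by half a symmetry. -/
theorem IsAWStar.exists_norm_sub_symmetry_le (hAW : IsAWStar A) (y : A) (hy : IsSelfAdjoint y)
    (hy1 : ‖y‖ ≤ 1) :
    ∃ e : A, IsStarProjection e ∧ ‖y - (e - (1 / 2 : ℝ) • (1 : A))‖ ≤ 1 / 2 ∧
      ∀ a : A, IsSelfAdjoint a → a * y = y * a → a * e = e * a := by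
  let _ := CStarAlgebra.spectralOrder A
  have _ := CStarAlgebra.spectralOrderedRing A
  obtain ⟨e, he, he1, he2⟩ := hAW.exists_support {y⁺}
  have hpe : y⁺ * e = y⁺ := he1 _ rfl
  have hdec : y⁺ - y⁻ = y := CFC.posPart_sub_negPart y hy
  have hp : 0 ≤ y⁺ := CFC.posPart_nonneg y
  have hn : 0 ≤ y⁻ := CFC.negPart_nonneg y
  have hen : e * y⁻ = 0 := he2 _ (by rintro s rfl; exact CFC.posPart_mul_negPart y)
  have hne : y⁻ * e = 0 := by
    have := congrArg star hen
    rwa [star_mul, he.isSelfAdjoint.star_eq, (IsSelfAdjoint.of_nonneg hn).star_eq,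
      star_zero] at this
  have hep : e * y⁺ = y⁺ := by
    have := congrArg star hpe
    rwa [star_mul, he.isSelfAdjoint.star_eq, (IsSelfAdjoint.of_nonneg hp).star_eq] at this
  have hye : y * e = y⁺ := by rw [← hdec, sub_mul, hpe, hne, sub_zero, hdec]
  have hey : e * y = y⁺ := by rw [← hdec, mul_sub, hep, hen, sub_zero, hdec]
  have hle : y ≤ 1 := hy.le_algebraMap_norm_self.trans (by
    rw [← map_one (algebraMap ℝ A)]; exact algebraMap_mono A hy1)
  have hge : -1 ≤ y := le_trans (by
    rw [← map_one (algebraMap ℝ A)]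
    exact neg_le_neg (algebraMap_mono A hy1)) hy.neg_algebraMap_norm_le_self
  have h1 : 0 ≤ e - y := by
    have h : e - y = e * (1 - y) * e + y⁻ := by
      rw [mul_assoc, sub_mul, one_mul, hye, mul_sub, he.isIdempotentElem.eq, hep]
      nth_rewrite 1 [← hdec]; abel
    rw [h]
    exact add_nonneg (he.isSelfAdjoint.conjugate_nonneg (sub_nonneg.2 hle)) hn
  have h2 : 0 ≤ 1 + y - e := by
    have h : 1 + y - e = (1 - e) * (1 + y) * (1 - e) + y⁺ := by
      have : y⁺ * e = y⁺ := hpe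
      simp only [mul_add, add_mul, mul_sub, sub_mul, one_mul, mul_one, he.isIdempotentElem.eq,
        hye, hey, hpe]
      abel
    rw [h]
    refine add_nonneg (he.one_sub.isSelfAdjoint.conjugate_nonneg ?_) hp
    have := sub_nonneg.2 hge
    rwa [sub_neg_eq_add, add_comm] at this
  refine ⟨e, he, ?_, fun a ha hay => ?_⟩
  · set z := y - (e - (1 / 2 : ℝ) • (1 : A)) with hz
    have hzs : IsSelfAdjoint z := by
      refine hy.sub (he.isSelfAdjoint.sub ?_)
      exact (IsSelfAdjoint.all (1 / 2 : ℝ)).smul (.one A)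
    have hhalf : algebraMap ℝ A (1 / 2) + algebraMap ℝ A (1 / 2) = 1 := by
      rw [← map_add]; norm_num
    have hz' : z = y - e + algebraMap ℝ A (1 / 2) := by
      rw [hz, Algebra.algebraMap_eq_smul_one]; abel
    have h3 : z ≤ algebraMap ℝ A (1 / 2) := by
      rw [← sub_nonneg, hz']
      convert h1 using 1; abel
    have h4 : algebraMap ℝ A (-(1 / 2)) ≤ z := by
      rw [← sub_nonneg, hz', map_neg]
      convert h2 using 1
      rw [← hhalf]; abel
    have h5 := (le_algebraMap_iff_spectrum_le hzs).1 h3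
    have h6 := (algebraMap_le_iff_le_spectrum hzs).1 h4
    rw [← cfc_id ℝ z]
    refine norm_cfc_le (by norm_num) fun t ht => ?_
    rw [id, Real.norm_eq_abs, abs_le]
    exact ⟨h6 t ht, h5 t ht⟩
  · have hc : Commute y⁺ a := by
      rw [CFC.posPart_def]
      exact (show Commute y a from hay.symm).cfcₙ_real _
    refine he.commute_support he1 he2 ?_ ?_
    · rintro s rfl; exact hc.eq
    · rintro s rfl; rw [ha.star_eq]; exact hc.eq

theorem IsAWStar.exists_projection_sum (hAW : IsAWStar A) {ι : Type*} (s q : ι → A)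
    (hs : ∀ i, IsStarProjection (s i)) (hq : ∀ i, IsStarProjection (q i))
    (hss : ∀ i j, i ≠ j → s i * s j = 0) (hqs : ∀ i, q i * s i = q i) :
    ∃ e : A, IsStarProjection e ∧ ∀ i, e * s i = q i := by
  obtain ⟨e, he, he1, he2⟩ := hAW.exists_support (Set.range q)
  have hsq : ∀ i, s i * q i = q i := fun i => by
    have := congrArg star (hqs i)
    rwa [star_mul, (hs i).isSelfAdjoint.star_eq, (hq i).isSelfAdjoint.star_eq] at this
  have heq : ∀ i, e * q i = q i := fun i => by
    have := congrArg star (he1 (q i) ⟨i, rfl⟩)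
    rwa [star_mul, he.isSelfAdjoint.star_eq, (hq i).isSelfAdjoint.star_eq] at this
  refine ⟨e, he, fun i => ?_⟩
  have h := he2 (s i - q i) ?_
  · rw [mul_sub, heq, sub_eq_zero] at h; exact h
  · rintro _ ⟨j, rfl⟩
    by_cases hij : j = i
    · subst hij; rw [mul_sub, hqs, (hq j).isIdempotentElem.eq, sub_self]
    · rw [← hqs j, ← hsq i, mul_sub, mul_assoc, mul_assoc, hss j i hij, ← mul_assoc (s j),
        hss j i hij]
      simp

theorem IsAWStar.exists_diagonal_of_contraction (hAW : IsAWStar A) {ι : Type*} (s x : ι → A)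
    (hs : ∀ i, IsStarProjection (s i)) (hss : ∀ i j, i ≠ j → s i * s j = 0)
    (hx : ∀ i, IsSelfAdjoint (x i)) (hxs : ∀ i, x i * s i = x i) (h1 : ∀ i, ‖x i‖ ≤ 1) :
    ∃ d : A, ∀ i, d * s i = x i := by
  choose! σ hσ hσn hσc using hAW.exists_norm_sub_symmetry_le
  let y : ι → ℕ → A := fun i k =>
    Nat.rec (x i) (fun _ z => (2 : ℝ) • (z - (σ z - (1 / 2 : ℝ) • (1 : A)))) k
  have y0 : ∀ i, y i 0 = x i := fun _ => rfl
  have yS : ∀ i k, y i (k + 1) =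
    (2 : ℝ) • (y i k - (σ (y i k) - (1 / 2 : ℝ) • (1 : A))) := fun _ _ => rfl
  have hone : IsSelfAdjoint ((1 / 2 : ℝ) • (1 : A)) :=
    (IsSelfAdjoint.all (1 / 2 : ℝ)).smul (.one A)
  have hy : ∀ i k, IsSelfAdjoint (y i k) ∧ ‖y i k‖ ≤ 1 ∧ s i * y i k = y i k * s i := by
    intro i k
    induction k with
    | zero =>
      refine ⟨hx i, h1 i, ?_⟩
      have := congrArg star (hxs i)
      rw [star_mul, (hs i).isSelfAdjoint.star_eq, (hx i).star_eq] at this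
      rw [y0, hxs, this]
    | succ k ih =>
      obtain ⟨ha, hb, hc⟩ := ih
      rw [yS]
      refine ⟨?_, ?_, ?_⟩
      · exact (IsSelfAdjoint.all (2 : ℝ)).smul (ha.sub ((hσ _ ha hb).isSelfAdjoint.sub hone))
      · rw [norm_smul, Real.norm_of_nonneg (by norm_num)]
        linarith [hσn _ ha hb]
      · rw [mul_smul_comm, smul_mul_assoc, mul_sub, sub_mul, mul_sub, sub_mul, hc,
          hσc _ ha hb _ (hs i).isSelfAdjoint hc]
        simp
  have hcom : ∀ i k, s i * σ (y i k) = σ (y i k) * s i := fun i k =>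
    hσc _ (hy i k).1 (hy i k).2.1 _ (hs i).isSelfAdjoint (hy i k).2.2
  have hq : ∀ i k, IsStarProjection (σ (y i k) * s i) := fun i k =>
    (hσ _ (hy i k).1 (hy i k).2.1).mul (hs i) (hcom i k).symm
  choose E hE hEs using fun k => hAW.exists_projection_sum s (fun i => σ (y i k) * s i) hs
    (fun i => hq i k) hss (fun i => by rw [mul_assoc, (hs i).isIdempotentElem.eq])
  have hsum : Summable fun k : ℕ => ((1 / 2 : ℝ) ^ k) • (E k - (1 / 2 : ℝ) • (1 : A)) := by
    refine Summable.of_norm_bounded (g := fun k => (1 / 2 : ℝ) ^ k * (1 + ‖(1 / 2 : ℝ) • (1 : A)‖))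
      (summable_geometric_two.mul_right _) fun k => ?_
    rw [norm_smul, Real.norm_of_nonneg (by positivity)]
    refine mul_le_mul_of_nonneg_left ((norm_sub_le _ _).trans ?_) (by positivity)
    gcongr
    exact (hE k).norm_le
  refine ⟨∑' k, ((1 / 2 : ℝ) ^ k) • (E k - (1 / 2 : ℝ) • (1 : A)), fun i => ?_⟩
  have ht := (hsum.hasSum.mul_right (s i)).tendsto_sum_nat
  refine tendsto_nhds_unique ht ?_
  have hpart : ∀ K, ∑ k ∈ Finset.range K,
      ((1 / 2 : ℝ) ^ k) • (E k - (1 / 2 : ℝ) • (1 : A)) * s i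
        = x i - ((1 / 2 : ℝ) ^ K) • (y i K * s i) := by
    intro K
    induction K with
    | zero => simp [y0, hxs]
    | succ K ih =>
      rw [Finset.sum_range_succ, ih, yS]
      simp only [smul_mul_assoc, sub_mul, hEs, one_mul, smul_sub, smul_smul, pow_succ]
      module
  simp only [hpart]
  have hz : Filter.Tendsto (fun K : ℕ => ((1 / 2 : ℝ) ^ K) • (y i K * s i)) Filter.atTop
      (nhds 0) := by
    refine squeeze_zero_norm (a := fun K => (1 / 2 : ℝ) ^ K) (fun K => ?_)
      (tendsto_pow_atTop_nhds_zero_of_lt_one (by norm_num) (by norm_num))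
    rw [norm_smul, Real.norm_of_nonneg (by positivity)]
    refine mul_le_of_le_one_right (by positivity) ((norm_mul_le _ _).trans ?_)
    exact mul_le_one₀ (hy i K).2.1 (norm_nonneg _) (hs i).norm_le
  simpa using tendsto_const_nhds.sub hz

theorem IsAWStar.exists_diagonal (hAW : IsAWStar A) {ι : Type*} (s x : ι → A)
    (hs : ∀ i, IsStarProjection (s i)) (hss : ∀ i j, i ≠ j → s i * s j = 0)
    (hxs : ∀ i, x i * s i = x i) (hsx : ∀ i, s i * x i = x i) (M : ℝ) (hM : ∀ i, ‖x i‖ ≤ M) :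
    ∃ d : A, ∀ i, d * s i = x i := by
  have key : ∀ x : ι → A, (∀ i, IsSelfAdjoint (x i)) → (∀ i, x i * s i = x i) →
      (∀ i, ‖x i‖ ≤ M) → ∃ d : A, ∀ i, d * s i = x i := by
    intro x hx hxs hM
    obtain ⟨d, hd⟩ := hAW.exists_diagonal_of_contraction s (fun i => ((|M| + 1)⁻¹ : ℝ) • x i)
      hs hss (fun i => (IsSelfAdjoint.all _).smul (hx i))
      (fun i => by rw [smul_mul_assoc, hxs]) (fun i => by
        rw [norm_smul, Real.norm_of_nonneg (by positivity), inv_mul_le_iff₀ (by positivity)]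
        linarith [hM i, le_abs_self M])
    refine ⟨(|M| + 1 : ℝ) • d, fun i => ?_⟩
    rw [smul_mul_assoc, hd, smul_smul, mul_inv_cancel₀ (by positivity), one_smul]
  have hstar : ∀ i, star (x i) * s i = star (x i) := fun i => by
    have := congrArg star (hsx i)
    rwa [star_mul, (hs i).isSelfAdjoint.star_eq] at this
  obtain ⟨d₁, h₁⟩ := key (fun i => (realPart (x i) : A)) (fun i => (realPart (x i)).2)
    (fun i => by rw [realPart_apply_coe, smul_mul_assoc, add_mul, hxs, hstar])
    (fun i => (realPart.norm_le _).trans (hM i))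
  obtain ⟨d₂, h₂⟩ := key (fun i => (imaginaryPart (x i) : A)) (fun i => (imaginaryPart (x i)).2)
    (fun i => by
      rw [imaginaryPart_apply_coe, smul_mul_assoc, smul_mul_assoc, sub_mul, hxs, hstar])
    (fun i => (imaginaryPart.norm_le _).trans (hM i))
  refine ⟨d₁ + Complex.I • d₂, fun i => ?_⟩
  rw [add_mul, smul_mul_assoc, h₁, h₂, realPart_add_I_smul_imaginaryPart]

theorem IsStarProjection.mul_star_eq {p x : A} (hp : IsStarProjection p) (h : x * p = x) :
    p * star x = star x := by
  rw [← hp.isSelfAdjoint.star_eq, ← star_mul, h]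

theorem IsStarProjection.star_mul_eq {p x : A} (hp : IsStarProjection p) (h : p * x = x) :
    star x * p = star x := by
  rw [← hp.isSelfAdjoint.star_eq, ← star_mul, h]

theorem IsStarProjection.mul_eq_self_comm {p q : A} (hp : IsStarProjection p)
    (hq : IsStarProjection q) (h : p * q = p) : q * p = p := by
  simpa only [hp.isSelfAdjoint.star_eq] using hq.mul_star_eq h

theorem mul_eq_zero_of_star {x y x' y' : A} (h : x * y = 0) (hx : star x = x') (hy : star y = y') :
    y' * x' = 0 := by
  rw [← hx, ← hy, ← star_mul, h, star_zero]

/-- The projection onto the graph of an orthogonal sum of operators. -/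
theorem IsAWStar.exists_graph_projection (hAW : IsAWStar A) {ι : Type*} (s x : ι → A)
    (hs : ∀ i, IsStarProjection (s i)) (hss : ∀ i j, i ≠ j → s i * s j = 0)
    (hsx : ∀ i, s i * x i = x i) (hxs : ∀ i j, x i * s j = 0)
    (hxx : ∀ i j, i ≠ j → x i * star (x j) = 0) :
    ∃ g : A, ∀ i, g * (s i + x i * star (x i)) = s i + star (x i) := by
  obtain ⟨g, hg, hg1, hg2⟩ := hAW.exists_support (Set.range fun i => s i + x i)
  refine ⟨g, fun i => ?_⟩
  have h1 : g * (s i + star (x i)) = s i + star (x i) := by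
    have := congrArg star (hg1 _ ⟨i, rfl⟩)
    simpa only [star_mul, star_add, hg.isSelfAdjoint.star_eq, (hs i).isSelfAdjoint.star_eq]
      using this
  have h2 : g * (x i * star (x i) - star (x i)) = 0 := by
    apply hg2
    rintro _ ⟨j, rfl⟩
    have hsx' : s j * star (x i) = 0 := by
      have := congrArg star (hxs i j)
      rwa [star_mul, (hs j).isSelfAdjoint.star_eq, star_zero] at this
    have hxx' : x j * (x i * star (x i)) = 0 := by
      rw [← hsx i, ← mul_assoc, ← mul_assoc, hxs, zero_mul, zero_mul]
    simp only [add_mul, mul_sub, hsx', hxx']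
    by_cases hij : j = i
    · subst hij; rw [← mul_assoc, hsx]; simp
    · rw [hxx j i hij, ← hsx i, mul_assoc, ← mul_assoc (s j), hss j i hij]
      simp
  rw [mul_sub, sub_eq_zero] at h2
  rw [mul_add, h2, ← mul_add, h1]

/-- Bounded column operators with domains in mutually centrally orthogonal corners. -/
theorem IsAWStar.exists_of_corner_eq_zero (hAW : IsAWStar A) {ι : Type*} (s c : ι → A)
    (hs : ∀ i, IsStarProjection (s i)) (hss : ∀ i j, i ≠ j → ∀ a, s i * a * s j = 0)
    (hcs : ∀ i, c i * s i = c i) (M : ℝ) (hM : ∀ i, ‖c i‖ ≤ M) :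
    ∃ d : A, ∀ i, d * s i = c i := by
  have hss' : ∀ i j, i ≠ j → s i * s j = 0 := fun i j h => by simpa using hss i j h 1
  obtain ⟨e, he, he1, he2⟩ := hAW.exists_support (Set.range s)
  have hse : ∀ i, s i * e = s i := fun i => he1 _ ⟨i, rfl⟩
  have hec : ∀ i, e * c i = s i * c i := by
    intro i
    have h := he2 (c i - s i * c i) ?_
    · have h' := (hs i).mul_eq_self_comm he (hse i)
      rw [mul_sub, ← mul_assoc, h', sub_eq_zero] at h
      exact h
    · rintro _ ⟨j, rfl⟩
      by_cases hij : j = i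
      · subst hij
        rw [mul_sub, ← mul_assoc, (hs j).isIdempotentElem.eq, sub_self]
      · rw [mul_sub, ← mul_assoc (s j), hss' j i hij, zero_mul, sub_zero, ← hcs i, ← mul_assoc,
          hss j i hij]
  have hn : ∀ i, ‖s i‖ ≤ 1 := fun i => (hs i).norm_le
  have hM0 : ∀ i : ι, 0 ≤ M := fun i => (norm_nonneg _).trans (hM i)
  obtain ⟨d₁, hd₁⟩ := hAW.exists_diagonal s (fun i => s i * c i) hs hss'
    (fun i => by rw [mul_assoc, hcs])
    (fun i => by rw [← mul_assoc, (hs i).isIdempotentElem.eq]) M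
    (fun i => (norm_mul_le _ _).trans (by nlinarith [hn i, hM i, hM0 i, norm_nonneg (c i)]))
  have hx : ∀ i, s i * star ((1 - e) * c i) = star ((1 - e) * c i) := fun i =>
    (hs i).mul_star_eq (by rw [mul_assoc, hcs])
  have hxs : ∀ i j, star ((1 - e) * c i) * s j = 0 := fun i j => by
    rw [← (hs j).isSelfAdjoint.star_eq, ← star_mul, ← mul_assoc, mul_sub, hse, mul_one,
      sub_self, zero_mul, star_zero]
  obtain ⟨g, hg⟩ := hAW.exists_graph_projection s (fun i => star ((1 - e) * c i)) hs hss' hx hxs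
    (fun i j h => by
      have := hss i j h (star ((1 - e) * c i) * ((1 - e) * c j))
      rwa [← mul_assoc, hx, mul_assoc, mul_assoc (1 - e), hcs, ← star_star ((1 - e) * c j)] at this)
  obtain ⟨d₂, hd₂⟩ := hAW.exists_diagonal s
    (fun i => s i + star ((1 - e) * c i) * star (star ((1 - e) * c i))) hs hss'
    (fun i => by
      rw [add_mul, (hs i).isIdempotentElem.eq, mul_assoc, star_star, mul_assoc _ (c i), hcs])
    (fun i => by rw [mul_add, (hs i).isIdempotentElem.eq, ← mul_assoc, hx])
    (1 + M * M)
    (fun i => by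
      refine (norm_add_le _ _).trans (add_le_add (hn i) ?_)
      rw [CStarRing.norm_self_mul_star, norm_star]
      have h1 : ‖(1 - e) * c i‖ ≤ M := (norm_mul_le _ _).trans (by
        nlinarith [he.one_sub.norm_le, hM i, hM0 i, norm_nonneg (c i)])
      exact mul_le_mul h1 h1 (norm_nonneg _) (hM0 i))
  refine ⟨d₁ + (1 - e) * g * d₂, fun i => ?_⟩
  rw [add_mul, hd₁, mul_assoc, hd₂, mul_assoc, hg, star_star, mul_add, ← mul_assoc,
    he.one_sub.isIdempotentElem.eq, sub_mul 1 e (s i), one_mul]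
  have h' := (hs i).mul_eq_self_comm he (hse i)
  rw [h', sub_self, zero_add, sub_mul, one_mul, hec]
  abel

theorem exists_self_adjoint_sqrt_one_sub {p h : A} (hh : IsSelfAdjoint h)
    (hh1 : ‖h‖ ≤ 1) (hph : p * h = h * p) :
    ∃ s : A, star s = s ∧ s * s = 1 - h ∧ p * s = s * p := by
  let _ := CStarAlgebra.spectralOrder A
  have _ := CStarAlgebra.spectralOrderedRing A
  have h0 : 0 ≤ 1 - h := by
    rw [sub_nonneg, ← map_one (algebraMap ℝ A)]
    exact hh.le_algebraMap_norm_self.trans (algebraMap_mono A hh1)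
  refine ⟨CFC.sqrt (1 - h), (IsSelfAdjoint.of_nonneg (CFC.sqrt_nonneg _)).star_eq,
    CFC.sqrt_mul_sqrt_self _ h0, ?_⟩
  have hc : Commute (1 - h) p := by
    rw [Commute, SemiconjBy, sub_mul, mul_sub, one_mul, mul_one, hph]
  exact (hc.cfcₙ_nnreal NNReal.sqrt).eq.symm

theorem IsStarProjection.mul_eq_of_mul_star_eq {p v : A} (hp : IsStarProjection p)
    (h : v * star v = p) : p * v = v := by
  rw [← sub_eq_zero, ← CStarRing.mul_star_self_eq_zero_iff]
  simp only [star_sub, star_mul, hp.isSelfAdjoint.star_eq, sub_mul, mul_sub]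
  rw [← mul_assoc (p * v), mul_assoc p v, ← mul_assoc v, h]
  simp [hp.isIdempotentElem.eq]

theorem exists_row_completion_step {P p C c Y v : A} (hp : IsStarProjection p)
    (hCP : C * P = C) (hcp : c * p = c) (hC : ‖C‖ ≤ 1 / 4) (hc : ‖c‖ ≤ 1 / 2)
    (hY : Y * star Y = P - star C * C) (hv : v * star v = p) (hYv : Y * star v = 0) :
    ∃ y : A, p * y = y ∧ y * star Y = -(star c * C) ∧ y * star y = p - star c * c ∧
      ∃ a b : A, y = a * Y + b * v := by
  have hCC : ‖star C * C‖ ≤ 1 / 16 := by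
    rw [CStarRing.norm_star_mul_self]; nlinarith [norm_nonneg C]
  obtain ⟨G, hG⟩ : ∃ G : A, G * (1 - star C * C) = 1 :=
    (isUnit_one_sub_of_norm_lt_one (by linarith : ‖star C * C‖ < 1)).exists_left_inv
  have hGstar : star G = G := by
    have h1 : (1 - star C * C) * star G = 1 := by
      have := congrArg star hG
      simpa using this
    calc star G = G * (1 - star C * C) * star G := by rw [hG, one_mul]
      _ = G := by rw [mul_assoc, h1, mul_one]
  have hGn : ‖G‖ ≤ 2 := by
    have h1 : G = 1 + G * (star C * C) := by
      rw [mul_sub, mul_one, sub_eq_iff_eq_add] at hG; exact hG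
    have h2 : ‖G‖ ≤ 1 + ‖G‖ * (1 / 16) := by
      conv_lhs => rw [h1]
      refine (norm_add_le _ _).trans (add_le_add (IsStarProjection.one A).norm_le ?_)
      exact (norm_mul_le _ _).trans (by gcongr)
    linarith
  set D := C * G * star C with hD
  have hDs : star D = D := by simp [hD, hGstar, mul_assoc]
  have hDn : ‖D‖ ≤ 1 / 8 := by
    calc ‖D‖ ≤ ‖C‖ * ‖G‖ * ‖star C‖ :=
          (norm_mul_le _ _).trans (mul_le_mul_of_nonneg_right (norm_mul_le _ _) (norm_nonneg _))
      _ ≤ 1 / 4 * 2 * (1 / 4) := by rw [norm_star]; gcongr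
      _ = 1 / 8 := by norm_num
  set h := star c * (1 + D) * c with hh
  have hpc : p * star c = star c := hp.mul_star_eq hcp
  have hph : p * h = h := by rw [hh, mul_assoc, ← mul_assoc, hpc]
  have hhp : h * p = h := by rw [hh, mul_assoc, hcp]
  obtain ⟨s, hs, hss, hps⟩ := exists_self_adjoint_sqrt_one_sub (p := p) (h := h)
    (by simp [IsSelfAdjoint, hh, hDs, mul_assoc]) (by
      calc ‖h‖ ≤ ‖star c‖ * ‖1 + D‖ * ‖c‖ :=
            (norm_mul_le _ _).trans (mul_le_mul_of_nonneg_right (norm_mul_le _ _) (norm_nonneg _))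
        _ ≤ 1 / 2 * (1 + 1 / 8) * (1 / 2) := by
          rw [norm_star]; gcongr
          exact (norm_add_le _ _).trans (add_le_add (IsStarProjection.one A).norm_le hDn)
        _ ≤ 1 := by norm_num) (by rw [hph, hhp])
  have hpv : p * v = v := hp.mul_eq_of_mul_star_eq hv
  have hvY : v * star Y = 0 := mul_eq_zero_of_star hYv rfl (star_star v)
  have hCGY : C * G * Y * star Y = C := by
    have h1 : P - star C * C = (1 - star C * C) * P := by
      rw [sub_mul, one_mul, mul_assoc, hCP]
    rw [mul_assoc, hY, h1, mul_assoc, ← mul_assoc G, hG, one_mul, hCP]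
  refine ⟨-(star c * (C * G * Y)) + s * v, ?_, ?_, ?_, -(star c * (C * G)), s, ?_⟩
  · rw [mul_add, mul_neg, ← mul_assoc, hpc, ← mul_assoc p s, hps, mul_assoc s, hpv]
  · rw [add_mul, neg_mul, mul_assoc, hCGY, mul_assoc s, hvY, mul_zero, add_zero]
  · have e1 : (star c * (C * G * Y)) * star (star c * (C * G * Y)) = star c * D * c := by
      simp only [star_mul, star_star, hGstar]
      calc _ = star c * (C * G * Y * star Y) * (G * star C) * c := by simp only [mul_assoc]
        _ = _ := by rw [hCGY, hD]; simp only [mul_assoc]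
    have e2 : (star c * (C * G * Y)) * star (s * v) = 0 := by
      rw [star_mul, mul_assoc, mul_assoc (C * G), ← mul_assoc Y, hYv]; simp
    have e3 : (s * v) * star (star c * (C * G * Y)) = 0 :=
      mul_eq_zero_of_star e2 rfl (star_star _)
    have e4 : (s * v) * star (s * v) = p - h := by
      rw [star_mul, hs, mul_assoc, ← mul_assoc v, hv, hps, ← mul_assoc, hss, sub_mul, one_mul, hhp]
    rw [star_add, star_neg, add_mul, mul_add, mul_add, neg_mul_neg, e1, neg_mul, e2, mul_neg, e3,
      e4, hh, mul_add, add_mul, mul_one]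
    abel
  · simp only [neg_mul, mul_assoc]

theorem sum_range_mul_of_orthogonal {p c : ℕ → A} (hpp : ∀ i j, i ≠ j → p i * p j = 0)
    (hcp : ∀ i, c i * p i = c i) {m n : ℕ} (h : m < n) :
    (∑ k ∈ Finset.range n, c k) * p m = c m := by
  rw [Finset.sum_mul, Finset.sum_eq_single_of_mem m (Finset.mem_range.2 h), hcp]
  intro k _ hk
  rw [← hcp k, mul_assoc, hpp k m hk, mul_zero]

theorem exists_row_completion (p v c : ℕ → A)
    (hp : ∀ i, IsStarProjection (p i)) (hpp : ∀ i j, i ≠ j → p i * p j = 0)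
    (hv : ∀ i, v i * star (v i) = p i) (hvv : ∀ i j, i ≠ j → v i * star (v j) = 0)
    (hcp : ∀ i, c i * p i = c i) (hC : ∀ N, ‖∑ n ∈ Finset.range N, c n‖ ≤ 1 / 4) :
    ∃ y : ℕ → A, (∀ i, p i * y i = y i) ∧ (∀ x, (∀ i, v i * x = 0) → ∀ i, y i * x = 0) ∧
      (∀ i, y i * star (y i) = p i - star (c i) * c i) ∧
      ∀ i j, i ≠ j → y i * star (y j) = -(star (c i) * c j) := by
  let P : ℕ → A := fun N => ∑ n ∈ Finset.range N, p n
  let C : ℕ → A := fun N => ∑ n ∈ Finset.range N, c n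
  have hPS : ∀ N, P (N + 1) = P N + p N := fun N => Finset.sum_range_succ _ _
  have hCS : ∀ N, C (N + 1) = C N + c N := fun N => Finset.sum_range_succ _ _
  let Inv : ℕ → A → Prop := fun N Y => Y * star Y = P N - star (C N) * C N ∧ P N * Y = Y ∧
    ∀ x, (∀ m < N, v m * x = 0) → Y * x = 0
  have hPp : ∀ N, P N * p N = 0 := fun N => by
    simp only [P, Finset.sum_mul]
    exact Finset.sum_eq_zero fun k hk => hpp _ _ (Finset.mem_range.1 hk).ne
  have hPs : ∀ N, IsSelfAdjoint (P N) := fun N => by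
    simp only [P, IsSelfAdjoint, star_sum, (hp _).isSelfAdjoint.star_eq]
  have hpP : ∀ N, p N * P N = 0 := fun N =>
    mul_eq_zero_of_star (hPp N) (hPs N).star_eq (hp N).isSelfAdjoint.star_eq
  have hCP : ∀ N, C N * P N = C N := fun N => by
    simp only [P, Finset.mul_sum]
    exact Finset.sum_congr rfl fun k hk =>
      sum_range_mul_of_orthogonal hpp hcp (Finset.mem_range.1 hk)
  have step : ∀ N Y, Inv N Y → ∃ y, Inv (N + 1) (Y + y) ∧ p N * y = y ∧
      y * star Y = -(star (c N) * C N) ∧ y * star y = p N - star (c N) * c N ∧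
      ∀ x, (∀ i, v i * x = 0) → y * x = 0 := by
    rintro N Y ⟨h1, h2, h3⟩
    obtain ⟨y, hpy, hyY, hyy, a, b, hab⟩ := exists_row_completion_step (hp N) (hCP N) (hcp N)
      (hC N) (by
        have e : c N = C (N + 1) - C N := by rw [hCS]; abel
        rw [e]
        exact (norm_sub_le _ _).trans (by linarith [hC N, hC (N + 1)])) h1 (hv N)
      (h3 _ fun m hm => hvv m N hm.ne)
    have hker : ∀ x, (∀ m < N + 1, v m * x = 0) → y * x = 0 := fun x hx => by
      rw [hab, add_mul, mul_assoc, mul_assoc, h3 x fun m hm => hx m (by omega), hx N (by omega)]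
      simp
    refine ⟨y, ⟨?_, ?_, ?_⟩, hpy, hyY, hyy, fun x hx => hker x fun m _ => hx m⟩
    · have hYy : Y * star y = -(star (C N) * c N) := by
        have := congrArg star hyY
        simpa using this
      rw [star_add, add_mul, mul_add, mul_add, h1, hYy, hyY, hyy, hPS, hCS, star_add, add_mul,
        mul_add, mul_add]
      abel
    · rw [hPS, add_mul, mul_add, mul_add, h2, hpy, ← hpy, ← mul_assoc, hPp, ← h2, ← mul_assoc,
        hpP]
      simp
    · intro x hx
      rw [add_mul, h3 x fun m hm => hx m (by omega), hker x hx, add_zero]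
  choose! F hF using step
  let Y : ℕ → A := fun n => Nat.rec 0 (fun N Z => Z + F N Z) n
  have hY0 : Y 0 = 0 := rfl
  have hYS : ∀ N, Y (N + 1) = Y N + F N (Y N) := fun _ => rfl
  have hInv : ∀ N, Inv N (Y N) := by
    intro N
    induction N with
    | zero => simp [Inv, hY0, P, C]
    | succ N ih => rw [hYS]; exact (hF N _ ih).1
  have hsum : ∀ N, Y N = ∑ n ∈ Finset.range N, F n (Y n) := by
    intro N
    induction N with
    | zero => rfl
    | succ N ih => rw [hYS, Finset.sum_range_succ, ← ih]
  have hlt : ∀ i j, j < i →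
      F i (Y i) * star (F j (Y j)) = -(star (c i) * c j) := by
    intro i j hij
    have h1 : star (Y i) * p j = star (F j (Y j)) := by
      rw [hsum, star_sum]
      exact sum_range_mul_of_orthogonal (c := fun n => star (F n (Y n))) hpp
        (fun n => (hp n).star_mul_eq (hF n _ (hInv n)).2.1) hij
    rw [← h1, ← mul_assoc, (hF i _ (hInv i)).2.2.1, neg_mul, mul_assoc,
      sum_range_mul_of_orthogonal hpp hcp hij]
  refine ⟨fun n => F n (Y n), fun i => (hF i _ (hInv i)).2.1,
    fun x hx i => (hF i _ (hInv i)).2.2.2.2 x hx, fun i => (hF i _ (hInv i)).2.2.2.1,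
    fun i j hij => ?_⟩
  rcases lt_or_gt_of_ne hij with h | h
  · have := congrArg star (hlt j i h)
    simpa using this
  · exact hlt i j h

theorem IsAWStar.exists_of_row_of_norm_le (hAW : IsAWStar A) (p v c : ℕ → A) (r : A)
    (hp : ∀ i, IsStarProjection (p i)) (hpp : ∀ i j, i ≠ j → p i * p j = 0)
    (hv : ∀ i, v i * star (v i) = p i) (hvv : ∀ i j, i ≠ j → v i * star (v j) = 0)
    (hvp : ∀ i j, v i * p j = 0) (hr : IsStarProjection r) (hrp : ∀ i, r * p i = 0)
    (hvr : ∀ i, v i * r = 0) (hrc : ∀ i, r * c i = c i) (hcp : ∀ i, c i * p i = c i)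
    (hC : ∀ N, ‖∑ n ∈ Finset.range N, c n‖ ≤ 1 / 4) :
    ∃ d : A, ∀ i, d * p i = c i := by
  obtain ⟨y, hpy, hker, hyy, hyy'⟩ := exists_row_completion p v c hp hpp hv hvv hcp hC
  have hyr : ∀ i, y i * r = 0 := hker r hvr
  have hry : ∀ i, r * star (y i) = 0 := fun i =>
    mul_eq_zero_of_star (hyr i) rfl hr.isSelfAdjoint.star_eq
  have hpr : ∀ i, p i * r = 0 := fun i =>
    mul_eq_zero_of_star (hrp i) hr.isSelfAdjoint.star_eq (hp i).isSelfAdjoint.star_eq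
  have hyc : ∀ i j, y i * c j = 0 := fun i j => by rw [← hrc, ← mul_assoc, hyr, zero_mul]
  have hcy : ∀ i j, star (c j) * star (y i) = 0 := fun i j =>
    mul_eq_zero_of_star (hyc i j) rfl rfl
  have hcsr : ∀ i, star (c i) * r = star (c i) := fun i => hr.star_mul_eq (hrc i)
  have hmul : ∀ i j, (star (c i) + y i) * star (star (c j) + y j) =
      star (c i) * c j + y i * star (y j) := fun i j => by
    rw [star_add, star_star, add_mul, mul_add, mul_add, hyc, hcy]
    abel
  obtain ⟨g, hg⟩ := hAW.exists_graph_projection p (fun i => star (c i) + y i) hp hpp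
    (fun i => by rw [mul_add, hpy, (hp i).mul_star_eq (hcp i)])
    (fun i j => by
      rw [add_mul, hker _ (fun k => hvp k j), ← hcsr, mul_assoc, hrp]
      simp)
    (fun i j hij => by rw [hmul, hyy' i j hij, add_neg_cancel])
  refine ⟨(2 : ℂ) • (r * g), fun i => ?_⟩
  have h := hg i
  rw [hmul, hyy, add_sub_cancel] at h
  replace h := congrArg (r * ·) h
  simp only [star_add, star_star, mul_add, hrp, hrc, hry] at h
  rw [smul_mul_assoc, two_smul, mul_assoc]
  simpa using h

theorem IsAWStar.exists_of_row (hAW : IsAWStar A) (p v c : ℕ → A) (r : A)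
    (hp : ∀ i, IsStarProjection (p i)) (hpp : ∀ i j, i ≠ j → p i * p j = 0)
    (hv : ∀ i, v i * star (v i) = p i) (hvv : ∀ i j, i ≠ j → v i * star (v j) = 0)
    (hvp : ∀ i j, v i * p j = 0) (hr : IsStarProjection r) (hrp : ∀ i, r * p i = 0)
    (hvr : ∀ i, v i * r = 0) (hrc : ∀ i, r * c i = c i) (hcp : ∀ i, c i * p i = c i)
    (M : ℝ) (hC : ∀ N, ‖∑ n ∈ Finset.range N, c n‖ ≤ M) :
    ∃ d : A, ∀ i, d * p i = c i := by
  obtain ⟨d, hd⟩ := hAW.exists_of_row_of_norm_le p v (fun i => ((4 * (|M| + 1))⁻¹ : ℝ) • c i) r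
    hp hpp hv hvv hvp hr hrp hvr (fun i => by rw [mul_smul_comm, hrc])
    (fun i => by rw [smul_mul_assoc, hcp]) (fun N => by
      rw [← Finset.smul_sum, norm_smul, Real.norm_of_nonneg (by positivity),
        inv_mul_le_iff₀ (by positivity)]
      linarith [hC N, le_abs_self M])
  refine ⟨(4 * (|M| + 1) : ℝ) • d, fun i => ?_⟩
  rw [smul_mul_assoc, hd, smul_smul, mul_inv_cancel₀ (by positivity), one_smul]

theorem IsStarProjection.mul_star_mul_self {v : A} (h : IsStarProjection (star v * v)) :
    v * (star v * v) = v := by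
  have := h.mul_eq_of_mul_star_eq (v := star v) (by rw [star_star])
  have := congrArg star this
  simpa [mul_assoc] using this

theorem IsStarProjection.self_mul_star {v : A} (h : IsStarProjection (star v * v)) :
    IsStarProjection (v * star v) :=
  ⟨by rw [IsIdempotentElem, mul_assoc, ← mul_assoc (star v), ← mul_assoc, h.mul_star_mul_self],
    .mul_star_self v⟩

theorem isStarProjection_sum_range {p : ℕ → A} (hp : ∀ i, IsStarProjection (p i))
    (hpp : ∀ i j, i ≠ j → p i * p j = 0) (N : ℕ) :
    IsStarProjection (∑ n ∈ Finset.range N, p n) := by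
  refine ⟨?_, by simp only [IsSelfAdjoint, star_sum, (hp _).isSelfAdjoint.star_eq]⟩
  rw [IsIdempotentElem, Finset.mul_sum]
  exact Finset.sum_congr rfl fun k hk => sum_range_mul_of_orthogonal hpp
    (fun i => (hp i).isIdempotentElem.eq) (Finset.mem_range.1 hk)

theorem norm_sum_range_le_one {v : ℕ → A} (hv : ∀ i, IsStarProjection (star (v i) * v i))
    (hvv : ∀ i j, i ≠ j → star (v i) * v j = 0) (hvv' : ∀ i j, i ≠ j → v i * star (v j) = 0)
    (N : ℕ) : ‖∑ n ∈ Finset.range N, v n‖ ≤ 1 := by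
  have h : star (∑ n ∈ Finset.range N, v n) * ∑ n ∈ Finset.range N, v n =
      ∑ n ∈ Finset.range N, star (v n) * v n := by
    rw [star_sum, Finset.sum_mul]
    refine Finset.sum_congr rfl fun i hi => ?_
    rw [Finset.mul_sum, Finset.sum_eq_single_of_mem i hi fun j _ hj => hvv i j hj.symm]
  have h1 : ‖∑ n ∈ Finset.range N, v n‖ * ‖∑ n ∈ Finset.range N, v n‖ ≤ 1 := by
    rw [← CStarRing.norm_star_mul_self, h]
    refine (isStarProjection_sum_range hv (fun i j hij => ?_) N).norm_le
    rw [mul_assoc, ← mul_assoc (v i), hvv' i j hij, zero_mul, mul_zero]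
  nlinarith [norm_nonneg (∑ n ∈ Finset.range N, v n)]

/-- Two partial isometries with the same initial projection, such that the initial projection and
the two final projections are mutually orthogonal. -/
structure IsTriple (v w : A) : Prop where
  isStarProjection : IsStarProjection (star v * v)
  star_mul_self : star w * w = star v * v
  mul_self : v * v = 0
  mul_eq : v * w = 0
  star_mul_eq : star v * w = 0

namespace IsTriple

variable {v w : A}

theorem w_eq (h : IsTriple v w) : w * (star v * v) = w := by
  rw [← h.star_mul_self]
  exact IsStarProjection.mul_star_mul_self (by rw [h.star_mul_self]; exact h.isStarProjection)

theorem v_eq (h : IsTriple v w) : v * (star v * v) = v := h.isStarProjection.mul_star_mul_self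

theorem mul_v (h : IsTriple v w) : w * v = 0 := by
  rw [← h.w_eq, mul_assoc, mul_assoc, h.mul_self, mul_zero, mul_zero]

theorem mul_w (h : IsTriple v w) : w * w = 0 := by
  conv_lhs => rw [← h.w_eq, mul_assoc, h.w_eq, mul_assoc, h.mul_eq, mul_zero, mul_zero]

theorem star_mul' (h : IsTriple v w) : star w * v = 0 :=
  mul_eq_zero_of_star h.star_mul_eq (star_star v) rfl

theorem symm (h : IsTriple v w) : IsTriple w v where
  isStarProjection := by rw [h.star_mul_self]; exact h.isStarProjection
  star_mul_self := h.star_mul_self.symm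
  mul_self := h.mul_w
  mul_eq := h.mul_v
  star_mul_eq := h.star_mul'

theorem rotate (h : IsTriple v w) : IsTriple (star v) (w * star v) where
  isStarProjection := by rw [star_star]; exact h.isStarProjection.self_mul_star
  star_mul_self := by
    rw [star_mul, star_star, mul_assoc, ← mul_assoc (star w), h.star_mul_self, ← mul_assoc,
      h.v_eq]
  mul_self := mul_eq_zero_of_star h.mul_self rfl rfl
  mul_eq := by rw [← mul_assoc, h.star_mul_eq, zero_mul]
  star_mul_eq := by rw [star_star, ← mul_assoc, h.mul_eq, zero_mul]

/-- The sum of the three projections of a triple. -/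
def total (v w : A) : A := star v * v + v * star v + w * star w

theorem total_symm (h : IsTriple v w) : total w v = total v w := by
  rw [total, total, h.star_mul_self]; abel

theorem total_rotate (h : IsTriple v w) : total (star v) (w * star v) = total v w := by
  have : w * star v * star (w * star v) = w * star w := by
    rw [star_mul, star_star, mul_assoc, ← mul_assoc (star v), ← mul_assoc, h.w_eq]
  rw [total, total, this, star_star]
  abel

theorem star_total (v w : A) : star (total v w) = total v w := by
  simp [total]

theorem mul_total (h : IsTriple v w) : v * total v w = v := by
  rw [total, mul_add, mul_add, h.v_eq, ← mul_assoc, ← mul_assoc, h.mul_self, h.mul_eq]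
  simp

theorem total_mul (h : IsTriple v w) : total v w * v = v := by
  rw [total, add_mul, add_mul, mul_assoc, mul_assoc, mul_assoc, h.mul_self, h.v_eq, h.star_mul']
  simp

theorem isStarProjection_total (h : IsTriple v w) : IsStarProjection (total v w) := by
  refine ⟨?_, star_total v w⟩
  have h1 : total v w * w = w := by rw [← h.total_symm]; exact h.symm.total_mul
  have h2 : total v w * star v = star v := by
    rw [← star_total, ← star_mul, h.mul_total]
  change total v w * (star v * v + v * star v + w * star w) = _
  rw [mul_add, mul_add, ← mul_assoc, ← mul_assoc, ← mul_assoc, h1, h2, h.total_mul, total]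

end IsTriple

/-- Extension from the initial projections of an orthogonal sequence of triples. -/
theorem IsAWStar.exists_of_triple (hAW : IsAWStar A) (v w c : ℕ → A)
    (hvw : ∀ i, IsTriple (v i) (w i))
    (hT : ∀ i j, i ≠ j → IsTriple.total (v i) (w i) * IsTriple.total (v j) (w j) = 0)
    (hc : ∀ i, c i * (star (v i) * v i) = c i)
    (M : ℝ) (hM : ∀ N, ‖∑ n ∈ Finset.range N, c n‖ ≤ M) :
    ∃ d : A, ∀ i, d * (star (v i) * v i) = c i := by
  have hM0 : 0 ≤ M := (norm_nonneg _).trans (hM 0)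
  have horth : ∀ i j x y, i ≠ j → x * IsTriple.total (v i) (w i) = x →
      IsTriple.total (v j) (w j) * y = y → x * y = 0 := fun i j x y hij hx hy => by
    rw [← hx, ← hy, mul_assoc, ← mul_assoc _ _ y, hT i j hij, zero_mul, mul_zero]
  have vT : ∀ i, v i * IsTriple.total (v i) (w i) = v i := fun i => (hvw i).mul_total
  have Tv : ∀ i, IsTriple.total (v i) (w i) * v i = v i := fun i => (hvw i).total_mul
  have wT : ∀ i, w i * IsTriple.total (v i) (w i) = w i := fun i => by
    rw [← (hvw i).total_symm]; exact (hvw i).symm.mul_total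
  have Tw : ∀ i, IsTriple.total (v i) (w i) * w i = w i := fun i => by
    rw [← (hvw i).total_symm]; exact (hvw i).symm.total_mul
  have hTp := fun i => (hvw i).isStarProjection_total
  have vsT : ∀ i, star (v i) * IsTriple.total (v i) (w i) = star (v i) := fun i =>
    (hTp i).star_mul_eq (Tv i)
  have wsT : ∀ i, star (w i) * IsTriple.total (v i) (w i) = star (w i) := fun i =>
    (hTp i).star_mul_eq (Tw i)
  have Tvs : ∀ i, IsTriple.total (v i) (w i) * star (v i) = star (v i) := fun i =>
    (hTp i).mul_star_eq (vT i)
  have Tws : ∀ i, IsTriple.total (v i) (w i) * star (w i) = star (w i) := fun i =>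
    (hTp i).mul_star_eq (wT i)
  have hvv : ∀ i j, v i * v j = 0 := fun i j => by
    by_cases h : i = j
    · subst h; exact (hvw i).mul_self
    · exact horth i j _ _ h (vT i) (Tv j)
  have hvw' : ∀ i j, v i * w j = 0 := fun i j => by
    by_cases h : i = j
    · subst h; exact (hvw i).mul_eq
    · exact horth i j _ _ h (vT i) (Tw j)
  have hvsw : ∀ i j, star (v i) * w j = 0 := fun i j => by
    by_cases h : i = j
    · subst h; exact (hvw i).star_mul_eq
    · exact horth i j _ _ h (vsT i) (Tw j)
  have hwsv : ∀ i j, star (w i) * v j = 0 := fun i j =>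
    mul_eq_zero_of_star (hvsw j i) (star_star _) rfl
  have hvsvs : ∀ i j, star (v i) * star (v j) = 0 := fun i j =>
    mul_eq_zero_of_star (hvv j i) rfl rfl
  have hwsvs : ∀ i j, star (w i) * star (v j) = 0 := fun i j =>
    mul_eq_zero_of_star (hvw' j i) rfl rfl
  have hvsv : ∀ i j, i ≠ j → star (v i) * v j = 0 := fun i j h => horth i j _ _ h (vsT i) (Tv j)
  have hwsw : ∀ i j, i ≠ j → star (w i) * w j = 0 := fun i j h => horth i j _ _ h (wsT i) (Tw j)
  have hvvs : ∀ i j, i ≠ j → v i * star (v j) = 0 := fun i j h => horth i j _ _ h (vT i) (Tvs j)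
  have hu : ∀ i, IsStarProjection (star (v i) * v i) := fun i => (hvw i).isStarProjection
  have hu' : ∀ i, IsStarProjection (v i * star (v i)) := fun i => (hu i).self_mul_star
  obtain ⟨e, he, he1, he2⟩ := hAW.exists_support (Set.range fun i => v i * star (v i))
  obtain ⟨e', he', he1', he2'⟩ := hAW.exists_support (Set.range fun i => w i * star (w i))
  have ev : ∀ i, e * v i = v i := fun i => by
    have h := (hu' i).mul_eq_self_comm he (he1 _ ⟨i, rfl⟩)
    rw [← (hvw i).v_eq, ← mul_assoc (v i), ← mul_assoc, h]
  have e'w : ∀ i, e' * w i = w i := fun i => by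
    have h := (hvw i).symm.isStarProjection.self_mul_star.mul_eq_self_comm he' (he1' _ ⟨i, rfl⟩)
    rw [← (hvw i).symm.v_eq, ← mul_assoc (w i), ← mul_assoc, h]
  have ew : ∀ i, e * w i = 0 := fun i => he2 _ (by
    rintro _ ⟨j, rfl⟩; rw [mul_assoc, hvsw, mul_zero])
  have evs : ∀ i, e * star (v i) = 0 := fun i => he2 _ (by
    rintro _ ⟨j, rfl⟩; rw [mul_assoc, hvsvs, mul_zero])
  have e'v : ∀ i, e' * v i = 0 := fun i => he2' _ (by
    rintro _ ⟨j, rfl⟩; rw [mul_assoc, hwsv, mul_zero])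
  have e'vs : ∀ i, e' * star (v i) = 0 := fun i => he2' _ (by
    rintro _ ⟨j, rfl⟩; rw [mul_assoc, hwsvs, mul_zero])
  have hee' : e * e' = 0 := he2 _ (by
    rintro _ ⟨j, rfl⟩
    rw [mul_assoc, mul_eq_zero_of_star (e'v j) he'.isSelfAdjoint.star_eq rfl, mul_zero])
  have he'e : e' * e = 0 :=
    mul_eq_zero_of_star hee' he.isSelfAdjoint.star_eq he'.isSelfAdjoint.star_eq
  have huu : ∀ i j, i ≠ j → (star (v i) * v i) * (star (v j) * v j) = 0 := fun i j h => by
    rw [mul_assoc, ← mul_assoc (v i), hvvs i j h, zero_mul, mul_zero]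
  have hwse : ∀ i, star (w i) * e = 0 := fun i =>
    mul_eq_zero_of_star (ew i) he.isSelfAdjoint.star_eq rfl
  have hws : ∀ i, star (w i) * star (star (w i)) = star (v i) * v i := fun i => by
    rw [star_star, (hvw i).star_mul_self]
  have hwsu : ∀ i j, star (w i) * (star (v j) * v j) = 0 := fun i j => by
    rw [← mul_assoc, hwsvs, zero_mul]
  have heu : ∀ i, e * (star (v i) * v i) = 0 := fun i => by rw [← mul_assoc, evs, zero_mul]
  have hlift : ∀ c : ℕ → A, (∀ i, e * c i = c i) → (∀ i, c i * (star (v i) * v i) = c i) →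
      (∃ M : ℝ, ∀ N, ‖∑ n ∈ Finset.range N, c n‖ ≤ M) →
      ∃ d : A, ∀ i, d * (star (v i) * v i) = c i := fun c h1 h2 ⟨M, hM⟩ =>
    hAW.exists_of_row _ (fun i => star (w i)) c e hu huu hws
      (fun i j h => by rw [star_star, hwsw i j h]) hwsu he heu hwse h1 h2 M hM
  have hproj : ∀ r : A, IsStarProjection r → ∀ N, ‖∑ n ∈ Finset.range N, r * c n‖ ≤ M :=
    fun r hr N => by
      rw [← Finset.mul_sum]
      refine (norm_mul_le _ _).trans ?_
      nlinarith [hr.norm_le, hM N, norm_nonneg (∑ n ∈ Finset.range N, c n), norm_nonneg r]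
  obtain ⟨d₁, hd₁⟩ := hlift (fun i => e * c i)
    (fun i => by rw [← mul_assoc, he.isIdempotentElem.eq]) (fun i => by rw [mul_assoc, hc])
    ⟨M, hproj e he⟩
  obtain ⟨V, hV⟩ := hlift v ev (fun i => (hvw i).v_eq)
    ⟨1, norm_sum_range_le_one hu hvsv hvvs⟩
  obtain ⟨d₂, hd₂⟩ := hAW.exists_of_row (fun i => star (v i) * v i) (fun i => star (v i))
    (fun i => e' * c i) e' hu huu
    (fun i => by rw [star_star]) (fun i j h => by rw [star_star, hvsv i j h])
    (fun i j => by rw [← mul_assoc, hvsvs, zero_mul]) he'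
    (fun i => by rw [← mul_assoc, e'vs, zero_mul])
    (fun i => mul_eq_zero_of_star (e'v i) he'.isSelfAdjoint.star_eq rfl)
    (fun i => by rw [← mul_assoc, he'.isIdempotentElem.eq]) (fun i => by rw [mul_assoc, hc])
    M (hproj e' he')
  set r := 1 - e - e' with hr
  have hrp : IsStarProjection r := by
    refine ⟨?_, ?_⟩
    · rw [IsIdempotentElem.eq_1, hr]
      simp only [mul_sub, sub_mul, mul_one, one_mul, he.isIdempotentElem.eq,
        he'.isIdempotentElem.eq, hee', he'e]
      abel
    · simp [IsSelfAdjoint, hr, he.isSelfAdjoint.star_eq, he'.isSelfAdjoint.star_eq]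
  have hrv : ∀ i, r * v i = 0 := fun i => by
    rw [hr, sub_mul, sub_mul, one_mul, ev, e'v, sub_self, sub_zero]
  have hwsr : ∀ i, star (w i) * r = 0 := fun i => by
    rw [hr, mul_sub, mul_sub, mul_one, hwse, he'.star_mul_eq (e'w i), sub_zero, sub_self]
  have hsum : ∀ N, ∑ n ∈ Finset.range N, r * c n * star (v n) =
      (∑ n ∈ Finset.range N, r * c n) * ∑ n ∈ Finset.range N, star (v n) := fun N => by
    rw [Finset.sum_mul]
    refine Finset.sum_congr rfl fun i hi => ?_
    rw [Finset.mul_sum, Finset.sum_eq_single_of_mem i hi]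
    intro j _ hj
    rw [← hc i, mul_assoc, mul_assoc, mul_assoc, hvvs i j hj.symm]
    simp
  obtain ⟨d₃, hd₃⟩ := hAW.exists_of_row (fun i => v i * star (v i)) (fun i => v i * star (w i))
    (fun i => r * c i * star (v i)) r hu'
    (fun i j h => by rw [mul_assoc, ← mul_assoc (star (v i)), hvsv i j h, zero_mul, mul_zero])
    (fun i => by
      rw [star_mul, star_star, mul_assoc, ← mul_assoc (star (w i)), (hvw i).star_mul_self,
        ← mul_assoc, (hvw i).v_eq])
    (fun i j h => by
      rw [star_mul, star_star, mul_assoc, ← mul_assoc (star (w i)), hwsw i j h, zero_mul, mul_zero])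
    (fun i j => by rw [mul_assoc, ← mul_assoc (star (w i)), hwsv, zero_mul, mul_zero])
    hrp (fun i => by rw [← mul_assoc, hrv, zero_mul])
    (fun i => by rw [mul_assoc, hwsr, mul_zero])
    (fun i => by rw [← mul_assoc, ← mul_assoc, hrp.isIdempotentElem.eq])
    (fun i => by
      rw [mul_assoc (r * c i), ← mul_assoc (star (v i)), (hu i).mul_star_eq (hvw i).v_eq])
    (M * 1) (fun N => by
      rw [hsum]
      refine (norm_mul_le _ _).trans (mul_le_mul (hproj r hrp N) ?_ (norm_nonneg _) hM0)
      rw [← star_sum, norm_star]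
      exact norm_sum_range_le_one hu hvsv hvvs N)
  refine ⟨d₁ + d₂ + d₃ * V, fun i => ?_⟩
  have h3 : d₃ * V * (star (v i) * v i) = r * c i := by
    have := congrArg (· * v i) (hd₃ i)
    rw [mul_assoc, hV, ← hc i, ← mul_assoc r, ← mul_assoc (r * c i), ← this, mul_assoc,
      mul_assoc (v i), (hvw i).v_eq]
  rw [add_mul, add_mul, hd₁, hd₂, h3, hr]
  simp only [sub_mul, one_mul]
  abel

theorem SigmaFiniteAlg.exists_maximal_orthogonal (hsf : SigmaFiniteAlg A) {X : Type*} (t : X → A)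
    (Q : X → Prop) (hQ : ∀ x, Q x → IsStarProjection (t x)) (x₀ : X) (h₀ : Q x₀) (ht₀ : t x₀ = 0) :
    ∃ x : ℕ → X, (∀ n, Q (x n)) ∧ (∀ n m, n ≠ m → t (x n) * t (x m) = 0) ∧
      ∀ y, Q y → (∀ n, t (x n) * t y = 0) → t y = 0 := by
  obtain ⟨S, hS⟩ := zorn_subset
    {S : Set X | (∀ x ∈ S, Q x ∧ t x ≠ 0) ∧ ∀ x ∈ S, ∀ y ∈ S, x ≠ y → t x * t y = 0} (by
      intro c hc hchain
      refine ⟨⋃₀ c, ⟨?_, ?_⟩, fun s hs => Set.subset_sUnion_of_mem hs⟩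
      · rintro x ⟨s, hs, hx⟩; exact (hc hs).1 x hx
      · rintro x ⟨s, hs, hx⟩ y ⟨s', hs', hy⟩ hxy
        rcases hchain.total hs hs' with h | h
        · exact (hc hs').2 x (h hx) y hy hxy
        · exact (hc hs).2 x hx y (h hy) hxy)
  obtain ⟨hS1, hS2⟩ := hS.prop
  have hinj : Set.InjOn t S := by
    intro x hx y hy hxy
    by_contra hne
    have h := hS2 x hx y hy hne
    rw [← hxy, (hQ x (hS1 x hx).1).isIdempotentElem.eq] at h
    exact (hS1 x hx).2 h
  have hcount : S.Countable := by
    refine Set.countable_of_injective_of_countable_image hinj (hsf _ ?_ ?_)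
    · rintro _ ⟨x, hx, rfl⟩
      have := hQ x (hS1 x hx).1
      exact ⟨this.isSelfAdjoint.star_eq, this.isIdempotentElem.eq, (hS1 x hx).2⟩
    · rintro _ ⟨x, hx, rfl⟩ _ ⟨y, hy, rfl⟩ hxy
      exact hS2 x hx y hy fun h => hxy (by rw [h])
  have : Countable S := hcount
  obtain ⟨g, hg⟩ := exists_injective_nat S
  have key : ∀ n : ℕ, ∃ x : X, (∀ s : S, g s = n → x = s) ∧ ((∃ s : S, g s = n) ∨ x = x₀) := by
    intro n
    by_cases h : ∃ s : S, g s = n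
    · obtain ⟨s, hs⟩ := h
      exact ⟨s, fun s' hs' => by rw [hg (hs.trans hs'.symm)], .inl ⟨s, hs⟩⟩
    · exact ⟨x₀, fun s hs => absurd ⟨s, hs⟩ h, .inr rfl⟩
  choose x hx1 hx2 using key
  refine ⟨x, fun n => ?_, fun n m hnm => ?_, fun y hy hyx => ?_⟩
  · rcases hx2 n with ⟨s, hs⟩ | h
    · rw [hx1 n s hs]; exact (hS1 s s.2).1
    · rwa [h]
  · rcases hx2 n with ⟨s, hs⟩ | h
    · rcases hx2 m with ⟨s', hs'⟩ | h'
      · rw [hx1 n s hs, hx1 m s' hs']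
        refine hS2 s s.2 s' s'.2 fun h => hnm ?_
        rw [← hs, ← hs', Subtype.ext h]
      · rw [h', ht₀, mul_zero]
    · rw [h, ht₀, zero_mul]
  · by_contra hne
    have horth : ∀ s ∈ S, t s * t y = 0 := fun s hs => by
      have := hyx (g ⟨s, hs⟩)
      rwa [hx1 _ ⟨s, hs⟩ rfl] at this
    have hmem : insert y S ⊆ S := hS.le_of_ge ⟨?_, ?_⟩ (Set.subset_insert y S)
    · have := horth y (hmem (Set.mem_insert y S))
      rw [(hQ y hy).isIdempotentElem.eq] at this
      exact hne this
    · rintro z (rfl | hz)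
      · exact ⟨hy, hne⟩
      · exact hS1 z hz
    · rintro z (rfl | hz) z' (rfl | hz') hzz
      · exact absurd rfl hzz
      · exact mul_eq_zero_of_star (horth z' hz') (hQ z' (hS1 z' hz').1).isSelfAdjoint.star_eq
          (hQ z hy).isSelfAdjoint.star_eq
      · exact horth z hz
      · exact hS2 z hz z' hz' hzz

/-- Two orthogonal projections that are linked by a partial isometry. -/
structure IsPair (z : A) : Prop where
  isStarProjection : IsStarProjection (star z * z)
  mul_self : z * z = 0

namespace IsPair

variable {z : A}

/-- The sum of the two projections of a pair. -/
def total (z : A) : A := star z * z + z * star z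

theorem star (h : IsPair z) : IsPair (star z) where
  isStarProjection := by rw [star_star]; exact h.isStarProjection.self_mul_star
  mul_self := mul_eq_zero_of_star h.mul_self rfl rfl

theorem total_star (z : A) : total (Star.star z) = total z := by
  rw [total, total, star_star, add_comm]

theorem star_total (z : A) : Star.star (total z) = total z := by
  simp [total]

theorem mul_total (h : IsPair z) : z * total z = z := by
  rw [total, mul_add, h.isStarProjection.mul_star_mul_self, ← mul_assoc, h.mul_self]
  simp

theorem total_mul (h : IsPair z) : total z * z = z := by
  rw [total, add_mul, mul_assoc, h.mul_self, mul_assoc, h.isStarProjection.mul_star_mul_self]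
  simp

theorem isStarProjection_total (h : IsPair z) : IsStarProjection (total z) := by
  refine ⟨?_, star_total z⟩
  have h2 : total z * Star.star z = Star.star z := by
    rw [← total_star]; exact h.star.total_mul
  change total z * (Star.star z * z + z * Star.star z) = _
  rw [mul_add, ← mul_assoc, ← mul_assoc, h2, h.total_mul, total]

end IsPair

/-- Once no further triple can be split off, the initial projections of orthogonal pairs
generate orthogonal ideals. -/
theorem IsAWStar.corner_eq_zero_of_maximal (hAW : IsAWStar A) {piece : A → Prop}
    (hpiece : ∀ u x, piece u → u * x = x → IsStarProjection (star x * x) → piece (x * star x))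
    (T : ℕ → A) (hTs : ∀ k, star (T k) = T k)
    (hmax : ∀ v w, IsTriple v w → piece (star v * v) → piece (v * star v) → piece (w * star w) →
      (∀ k, T k * IsTriple.total v w = 0) → IsTriple.total v w = 0)
    (z : ℕ → A) (hz : ∀ k, IsPair (z k)) (hz1 : ∀ k, piece (star (z k) * z k))
    (hz2 : ∀ k, piece (z k * star (z k))) (hTz : ∀ j k, T j * z k = 0) (hzT : ∀ j k, z k * T j = 0)
    (hzz : ∀ i j, i ≠ j → IsPair.total (z i) * IsPair.total (z j) = 0) (i j : ℕ) (hij : i ≠ j)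
    (x : A) : (star (z i) * z i) * x * (star (z j) * z j) = 0 := by
  by_contra hne
  obtain ⟨v, hv0, hv, hiv, hvj⟩ := hAW.exists_partial_isometry (hz i).isStarProjection
    (hz j).isStarProjection x hne
  have horth : ∀ i j x y, i ≠ j → x * IsPair.total (z i) = x →
      IsPair.total (z j) * y = y → x * y = 0 := fun i j x y hij hx hy => by
    rw [← hx, ← hy, mul_assoc, ← mul_assoc _ _ y, hzz i j hij, zero_mul, mul_zero]
  have hzi : z i * z j = 0 := horth i j _ _ hij (hz i).mul_total (hz j).total_mul
  have hzji : z j * star (z i) = 0 := horth j i _ _ hij.symm (hz j).mul_total (by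
    rw [← IsPair.total_star]; exact (hz i).star.total_mul)
  have hjv : star (z j) * z j * star v = star v := (hz j).isStarProjection.mul_star_eq hvj
  have hww : star (z j * (star v * v)) * (z j * (star v * v)) = star v * v := by
    calc star (z j * (star v * v)) * (z j * (star v * v))
        = star v * v * (star (z j) * z j * star v) * v := by
          simp only [star_mul, star_star, mul_assoc]
      _ = star v * v := by rw [hjv, mul_assoc _ _ v, hv.isIdempotentElem.eq]
  have htr : IsTriple v (z j * (star v * v)) := by
    refine ⟨hv, hww, ?_, ?_, ?_⟩
    · calc v * v = v * (star (z j) * z j) * (star (z i) * z i * v) := by rw [hvj, hiv]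
        _ = v * star (z j) * (z j * star (z i)) * (z i * v) := by simp only [mul_assoc]
        _ = 0 := by rw [hzji, mul_zero, zero_mul]
    · conv_lhs => rw [← hvj]
      rw [mul_assoc, mul_assoc (star (z j)), ← mul_assoc (z j) (z j), (hz j).mul_self]
      simp
    · rw [← hiv, star_mul, star_mul, star_star, ← mul_assoc, mul_assoc _ _ (z j),
        mul_assoc _ _ (z j), hzi]
      simp
  have hTzs : ∀ j k, T j * star (z k) = 0 := fun j k =>
    mul_eq_zero_of_star (hzT j k) rfl (hTs j)
  have h0 := hmax v _ htr
    (by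
      have := hpiece _ (star v) (hz1 j) hjv (by rw [star_star]; exact hv.self_mul_star)
      rwa [star_star] at this)
    (hpiece _ v (hz1 i) hiv hv)
    (hpiece _ _ (hz2 j) (by rw [← mul_assoc, mul_assoc (z j),
      (hz j).isStarProjection.mul_star_mul_self]) (by rw [hww]; exact hv))
    (fun k => by
      have h1 : T k * v = 0 := by
        rw [← hiv, ← mul_assoc, ← mul_assoc, hTzs, zero_mul, zero_mul]
      have h2 : T k * star v = 0 := by
        rw [← hjv, ← mul_assoc, ← mul_assoc, hTzs, zero_mul, zero_mul]
      rw [IsTriple.total, mul_add, mul_add, ← mul_assoc, ← mul_assoc, ← mul_assoc, ← mul_assoc,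
        h1, h2, hTz]
      simp)
  apply hv0
  rw [← htr.mul_total, h0, mul_zero]

/-- A bounded right module map on a right ideal, as an unbundled function. -/
structure IsBoundedModuleMap (I : Submodule ℂ A) (f : A → A) : Prop where
  isRightIdeal : IsRightIdeal I
  map_add : ∀ x ∈ I, ∀ y ∈ I, f (x + y) = f x + f y
  map_mul : ∀ x ∈ I, ∀ r : A, f (x * r) = f x * r
  bounded : ∃ C : ℝ, 0 ≤ C ∧ ∀ x ∈ I, ‖f x‖ ≤ C * ‖x‖

namespace IsBoundedModuleMap

variable {I : Submodule ℂ A} {f : A → A}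

theorem map_zero (h : IsBoundedModuleMap I f) : f 0 = 0 := by
  have := h.map_mul 0 I.zero_mem 0
  rwa [mul_zero, mul_zero] at this

theorem map_sum (h : IsBoundedModuleMap I f) {u : ℕ → A} (hu : ∀ i, u i ∈ I) (N : ℕ) :
    f (∑ n ∈ Finset.range N, u n) = ∑ n ∈ Finset.range N, f (u n) := by
  induction N with
  | zero => simpa using h.map_zero
  | succ N ih =>
    rw [Finset.sum_range_succ, Finset.sum_range_succ,
      h.map_add _ (I.sum_mem fun i _ => hu i) _ (hu N), ih]

theorem map_mul_self (h : IsBoundedModuleMap I f) {u : A} (hu : u ∈ I) (hp : IsStarProjection u) :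
    f u * u = f u := by
  rw [← h.map_mul u hu, hp.isIdempotentElem.eq]

theorem exists_of_corner_eq_zero (h : IsBoundedModuleMap I f) (hAW : IsAWStar A) (s : ℕ → A)
    (hI : ∀ i, s i ∈ I) (hs : ∀ i, IsStarProjection (s i))
    (hss : ∀ i j, i ≠ j → ∀ a, s i * a * s j = 0) : ∃ d : A, ∀ i, d * s i = f (s i) := by
  obtain ⟨C, hC0, hC⟩ := h.bounded
  refine hAW.exists_of_corner_eq_zero s (fun i => f (s i)) hs hss
    (fun i => h.map_mul_self (hI i) (hs i)) C fun i => (hC _ (hI i)).trans ?_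
  nlinarith [(hs i).norm_le]

theorem exists_of_triple (h : IsBoundedModuleMap I f) (hAW : IsAWStar A) (v w : ℕ → A)
    (hI : ∀ i, star (v i) * v i ∈ I) (hvw : ∀ i, IsTriple (v i) (w i))
    (hT : ∀ i j, i ≠ j → IsTriple.total (v i) (w i) * IsTriple.total (v j) (w j) = 0) :
    ∃ d : A, ∀ i, d * (star (v i) * v i) = f (star (v i) * v i) := by
  obtain ⟨C, hC0, hC⟩ := h.bounded
  refine hAW.exists_of_triple v w (fun i => f (star (v i) * v i)) hvw hT
    (fun i => h.map_mul_self (hI i) (hvw i).isStarProjection) C fun N => ?_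
  rw [← h.map_sum hI]
  refine (hC _ (I.sum_mem fun i _ => hI i)).trans ?_
  have hv : ∀ i j, i ≠ j → v i * star (v j) = 0 := fun i j hij => by
    rw [← (hvw i).mul_total, ← (hvw j).isStarProjection_total.mul_star_eq (hvw j).mul_total,
      mul_assoc, ← mul_assoc _ _ (star (v j)), hT i j hij, zero_mul, mul_zero]
  have := (isStarProjection_sum_range (fun i => (hvw i).isStarProjection) (fun i j hij => by
    rw [mul_assoc, ← mul_assoc (v i), hv i j hij, zero_mul, mul_zero]) N).norm_le
  nlinarith

end IsBoundedModuleMap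

/-- `f` is implemented on the set `S` by a left multiplication. -/
def IsImplementedOn (f : A → A) (S : Set A) : Prop := ∃ c : A, ∀ u ∈ S, c * u = f u

theorem IsImplementedOn.union (hAW : IsAWStar A) {f : A → A} {S T : Set A}
    (hS : IsImplementedOn f S) (hT : IsImplementedOn f T) (hSp : ∀ s ∈ S, IsStarProjection s)
    (hST : ∀ s ∈ S, ∀ t ∈ T, s * t = 0) : IsImplementedOn f (S ∪ T) := by
  obtain ⟨c₁, h₁⟩ := hS
  obtain ⟨c₂, h₂⟩ := hT
  obtain ⟨e, he, he1, he2⟩ := hAW.exists_support S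
  refine ⟨c₁ * e + c₂ * (1 - e), ?_⟩
  rintro u (hu | hu)
  · have : e * u = u := (hSp u hu).mul_eq_self_comm he (he1 u hu)
    rw [add_mul, mul_assoc, mul_assoc, sub_mul, this, h₁ u hu, one_mul, sub_self, mul_zero,
      add_zero]
  · have : e * u = 0 := he2 u fun s hs => hST s hs u hu
    rw [add_mul, mul_assoc, mul_assoc, sub_mul, this, one_mul, sub_zero, h₂ u hu, mul_zero,
      zero_add]

/-- A projection dominated by one of the `p n`. -/
def IsPiece (p : ℕ → A) (u : A) : Prop := IsStarProjection u ∧ ∃ n, p n * u = u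

namespace IsPiece

variable {p : ℕ → A} {u : A}

theorem mem {I : Submodule ℂ A} (hI : IsRightIdeal I) (hpI : ∀ n, p n ∈ I) (h : IsPiece p u) :
    u ∈ I := by
  obtain ⟨-, n, hn⟩ := h
  rw [← hn]; exact hI _ (hpI n) _

theorem of_mul_eq {x : A} (h : IsPiece p u) (hx : u * x = x) (hxx : IsStarProjection (star x * x)) :
    IsPiece p (x * star x) := by
  obtain ⟨-, n, hn⟩ := h
  refine ⟨hxx.self_mul_star, n, ?_⟩
  rw [← mul_assoc]
  nth_rewrite 1 [← hx]
  rw [← mul_assoc, hn, hx]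

theorem mul_eq_or (hpp : ∀ i j, i ≠ j → p i * p j = 0) (h : IsPiece p u) (m : ℕ) :
    p m * u = u ∨ p m * u = 0 := by
  obtain ⟨-, n, hn⟩ := h
  by_cases hmn : m = n
  · subst hmn; exact .inl hn
  · right; rw [← hn, ← mul_assoc, hpp m n hmn, zero_mul]

theorem commute (hp : ∀ i, IsStarProjection (p i)) (hpp : ∀ i j, i ≠ j → p i * p j = 0)
    (h : IsPiece p u) (m : ℕ) : u * p m = p m * u := by
  rcases h.mul_eq_or hpp m with h' | h'
  · have := (hp m).star_mul_eq h'
    rw [h.1.isSelfAdjoint.star_eq] at this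
    rw [this, h']
  · rw [h', mul_eq_zero_of_star h' (hp m).isSelfAdjoint.star_eq h.1.isSelfAdjoint.star_eq]

theorem zero : IsPiece p 0 := ⟨.zero A, 0, mul_zero _⟩

theorem map_sub_mul_eq_zero (hpp : ∀ i j, i ≠ j → p i * p j = 0)
    {I : Submodule ℂ A} {f : A → A} (hf : IsBoundedModuleMap I f) (hpI : ∀ n, p n ∈ I)
    (h : IsPiece p u) {c : A} (hc : c * u = f u) (m : ℕ) : (c * p m - f (p m)) * u = 0 := by
  rw [sub_mul, mul_assoc, ← hf.map_mul _ (hpI m)]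
  rcases h.mul_eq_or hpp m with h' | h'
  · rw [h', hc, sub_self]
  · rw [h', mul_zero, hf.map_zero, sub_zero]

end IsPiece

theorem IsBoundedModuleMap.exists_of_orthogonal_projections {I : Submodule ℂ A} {f : A → A}
    (hf : IsBoundedModuleMap I f) (hAW : IsAWStar A) (hsf : SigmaFiniteAlg A) (p : ℕ → A)
    (hpI : ∀ n, p n ∈ I) (hp : ∀ i, IsStarProjection (p i))
    (hpp : ∀ i j, i ≠ j → p i * p j = 0) : ∃ c : A, ∀ n, c * p n = f (p n) := by
  have hI := hf.isRightIdeal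
  obtain ⟨x, hx, hxx, hxmax⟩ := hsf.exists_maximal_orthogonal
    (fun x : A × A => IsTriple.total x.1 x.2)
    (fun x => IsTriple x.1 x.2 ∧ IsPiece p (star x.1 * x.1) ∧ IsPiece p (x.1 * star x.1) ∧
      IsPiece p (x.2 * star x.2))
    (fun x h => h.1.isStarProjection_total) (0, 0)
    (by simpa using ⟨⟨by simp, by simp, by simp, by simp, by simp⟩, IsPiece.zero⟩)
    (by simp [IsTriple.total])
  let v : ℕ → A := fun k => (x k).1
  let w : ℕ → A := fun k => (x k).2
  let T : ℕ → A := fun k => IsTriple.total (v k) (w k)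
  have hvw : ∀ k, IsTriple (v k) (w k) := fun k => (hx k).1
  have hTs : ∀ k, star (T k) = T k := fun k => IsTriple.star_total _ _
  have hTp : ∀ k, IsStarProjection (T k) := fun k => (hvw k).isStarProjection_total
  have hTT : ∀ i j, i ≠ j → T i * T j = 0 := hxx
  have hmax : ∀ v w, IsTriple v w → IsPiece p (star v * v) → IsPiece p (v * star v) →
      IsPiece p (w * star w) → (∀ k, T k * IsTriple.total v w = 0) → IsTriple.total v w = 0 :=
    fun v w h1 h2 h3 h4 h5 => hxmax (v, w) ⟨h1, h2, h3, h4⟩ h5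
  clear hxmax
  obtain ⟨z, hz, hzz, hzmax⟩ := hsf.exists_maximal_orthogonal (IsPair.total (A := A))
    (fun z => IsPair z ∧ IsPiece p (star z * z) ∧ IsPiece p (z * star z) ∧ (∀ k, T k * z = 0) ∧
      ∀ k, z * T k = 0)
    (fun z h => h.1.isStarProjection_total) 0
    (by simpa using ⟨⟨by simp, by simp⟩, IsPiece.zero⟩)
    (by simp [IsPair.total])
  have hpair : ∀ k, IsPair (z k) := fun k => (hz k).1
  let F : ℕ → A := fun k => IsPair.total (z k)
  have hFp : ∀ k, IsStarProjection (F k) := fun k => (hpair k).isStarProjection_total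
  have hFs : ∀ k, star (F k) = F k := fun k => IsPair.star_total _
  have hTz : ∀ j k, T j * z k = 0 := fun j k => (hz k).2.2.2.1 j
  have hzT : ∀ j k, z k * T j = 0 := fun j k => (hz k).2.2.2.2 j
  have hTzs : ∀ j k, T j * star (z k) = 0 := fun j k => mul_eq_zero_of_star (hzT j k) rfl (hTs j)
  have hzsT : ∀ j k, star (z k) * T j = 0 := fun j k => mul_eq_zero_of_star (hTz j k) (hTs j) rfl
  have hTF : ∀ j k, T j * F k = 0 := fun j k => by
    simp only [F, IsPair.total]
    rw [mul_add, ← mul_assoc, ← mul_assoc, hTz, hTzs, zero_mul, zero_mul, add_zero]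
  have hpiece : ∀ u x, IsPiece p u → u * x = x → IsStarProjection (star x * x) →
      IsPiece p (x * star x) := fun u x h1 h2 h3 => h1.of_mul_eq h2 h3
  have ha := hAW.corner_eq_zero_of_maximal hpiece T hTs hmax z hpair (fun k => (hz k).2.1)
    (fun k => (hz k).2.2.1) hTz hzT hzz
  have hb := hAW.corner_eq_zero_of_maximal hpiece T hTs hmax (fun k => star (z k))
    (fun k => (hpair k).star) (fun k => by rw [star_star]; exact (hz k).2.2.1)
    (fun k => by rw [star_star]; exact (hz k).2.1) hTzs hzsT
    (fun i j hij => by rw [IsPair.total_star, IsPair.total_star]; exact hzz i j hij)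
  simp only [star_star] at hb
  obtain ⟨E, hE, hE1, hE2⟩ := hAW.exists_support (Set.range T)
  obtain ⟨G, hG, hG1, hG2⟩ := hAW.exists_support (Set.range F)
  have hTE : ∀ k, T k * E = T k := fun k => hE1 _ ⟨k, rfl⟩
  have hFG : ∀ k, F k * G = F k := fun k => hG1 _ ⟨k, rfl⟩
  have hEF : ∀ k, E * F k = 0 := fun k => hE2 _ (by rintro _ ⟨j, rfl⟩; exact hTF j k)
  have hFE : ∀ k, F k * E = 0 := fun k =>
    mul_eq_zero_of_star (hEF k) hE.isSelfAdjoint.star_eq (hFs k)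
  have hGE : G * E = 0 := hG2 _ (by rintro _ ⟨j, rfl⟩; exact hFE j)
  have hEG : E * G = 0 := mul_eq_zero_of_star hGE hG.isSelfAdjoint.star_eq hE.isSelfAdjoint.star_eq
  have hTG : ∀ k, T k * G = 0 := fun k => by rw [← hTE, mul_assoc, hEG, mul_zero]
  have hpE : ∀ n, p n * E = E * p n := fun n => by
    have h : ∀ s ∈ Set.range T, s * p n = p n * s := by
      rintro _ ⟨k, rfl⟩
      simp only [T, IsTriple.total, add_mul, mul_add]
      rw [(hx k).2.1.commute hp hpp, (hx k).2.2.1.commute hp hpp, (hx k).2.2.2.commute hp hpp]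
    exact hE.commute_support hE1 hE2 h (by rwa [(hp n).isSelfAdjoint.star_eq])
  have hpG : ∀ n, p n * G = G * p n := fun n => by
    have h : ∀ s ∈ Set.range F, s * p n = p n * s := by
      rintro _ ⟨k, rfl⟩
      simp only [F, IsPair.total, add_mul, mul_add]
      rw [(hz k).2.1.commute hp hpp, (hz k).2.2.1.commute hp hpp]
    exact hG.commute_support hG1 hG2 h (by rwa [(hp n).isSelfAdjoint.star_eq])
  set q := 1 - E - G with hq
  have hqp : IsStarProjection q := by
    refine ⟨?_, ?_⟩
    · rw [IsIdempotentElem.eq_1, hq]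
      simp only [mul_sub, sub_mul, mul_one, one_mul, hE.isIdempotentElem.eq,
        hG.isIdempotentElem.eq, hEG, hGE]
      abel
    · simp [IsSelfAdjoint, hq, hE.isSelfAdjoint.star_eq, hG.isSelfAdjoint.star_eq]
  have hpq : ∀ n, p n * q = q * p n := fun n => by
    rw [hq, mul_sub, mul_sub, sub_mul, sub_mul, hpE, hpG, mul_one, one_mul]
  have hTq : ∀ k, T k * q = 0 := fun k => by
    rw [hq, mul_sub, mul_sub, mul_one, hTE, hTG, sub_self, sub_zero]
  have hFq : ∀ k, F k * q = 0 := fun k => by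
    rw [hq, mul_sub, mul_sub, mul_one, hFE, hFG, sub_zero, sub_self]
  have hs : ∀ n, IsStarProjection (p n * q) := fun n => (hp n).mul hqp (hpq n)
  have hps : ∀ n, p n * (p n * q) = p n * q := fun n => by
    rw [← mul_assoc, (hp n).isIdempotentElem.eq]
  have hqs : ∀ n, q * (p n * q) = p n * q := fun n => by
    rw [hpq, ← mul_assoc, hqp.isIdempotentElem.eq]
  have hsp : ∀ n, p n * q * p n = p n * q := fun n => by
    rw [mul_assoc, ← hpq, hps]
  have hsq : ∀ n, p n * q * q = p n * q := fun n => by rw [mul_assoc, hqp.isIdempotentElem.eq]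
  have hss : ∀ i j, i ≠ j → ∀ a, (p i * q) * a * (p j * q) = 0 := by
    intro i j hij a
    by_contra hne
    obtain ⟨y, hy0, hy, hiy, hyj⟩ := hAW.exists_partial_isometry (hs i) (hs j) a hne
    have hpy : p i * y = y := by rw [← hiy, ← mul_assoc, hps]
    have hyp : y * p j = y := by rw [← hyj, mul_assoc, hsp]
    have hqy : q * y = y := by rw [← hiy, ← mul_assoc, hqs]
    have hyq : y * q = y := by rw [← hyj, mul_assoc, hsq]
    have hqys : q * star y = star y := hqp.mul_star_eq hyq
    have hTy : ∀ k, T k * y = 0 := fun k => by rw [← hqy, ← mul_assoc, hTq, zero_mul]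
    have hTys : ∀ k, T k * star y = 0 := fun k => by rw [← hqys, ← mul_assoc, hTq, zero_mul]
    have hyP : IsPair y := ⟨hy, by
      rw [← hpy]
      nth_rewrite 1 [hpy]
      rw [← hyp, mul_assoc, ← mul_assoc (p j), hpp j i hij.symm, zero_mul, mul_zero]⟩
    have h0 : IsPair.total y = 0 := by
      refine hzmax y ⟨hyP, ⟨hy, j, ?_⟩, ⟨hy.self_mul_star, i, ?_⟩, hTy, fun k =>
        mul_eq_zero_of_star (hTys k) (hTs k) (star_star y)⟩ fun k => ?_
      · rw [← mul_assoc, (hp j).mul_star_eq hyp]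
      · rw [← mul_assoc, hpy]
      · change F k * _ = 0
        have h1 : F k * y = 0 := by rw [← hqy, ← mul_assoc, hFq, zero_mul]
        have h2 : F k * star y = 0 := by rw [← hqys, ← mul_assoc, hFq, zero_mul]
        rw [IsPair.total, mul_add, ← mul_assoc, ← mul_assoc, h1, h2, zero_mul, zero_mul, add_zero]
    rw [← hyP.mul_total, h0, mul_zero] at hy0
    exact hy0 rfl
  obtain ⟨d₁, hd₁⟩ := hf.exists_of_triple hAW v w (fun k => (hx k).2.1.mem hI hpI) hvw hTT
  obtain ⟨d₂, hd₂⟩ := hf.exists_of_triple hAW _ _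
    (fun k => by rw [star_star]; exact (hx k).2.2.1.mem hI hpI) (fun k => (hvw k).rotate)
    (fun i j hij => by
      rw [(hvw i).total_rotate, (hvw j).total_rotate]; exact hTT i j hij)
  obtain ⟨d₃, hd₃⟩ := hf.exists_of_triple hAW _ _
    (fun k => by rw [star_star]; exact (hx k).2.2.2.mem hI hpI) (fun k => (hvw k).symm.rotate)
    (fun i j hij => by
      rw [(hvw i).symm.total_rotate, (hvw j).symm.total_rotate, (hvw i).total_symm,
        (hvw j).total_symm]
      exact hTT i j hij)
  obtain ⟨d₄, hd₄⟩ := hf.exists_of_corner_eq_zero hAW (fun k => star (z k) * z k)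
    (fun k => (hz k).2.1.mem hI hpI) (fun k => (hpair k).isStarProjection) ha
  obtain ⟨d₅, hd₅⟩ := hf.exists_of_corner_eq_zero hAW (fun k => z k * star (z k))
    (fun k => (hz k).2.2.1.mem hI hpI) (fun k => (hpair k).isStarProjection.self_mul_star) hb
  obtain ⟨d₆, hd₆⟩ := hf.exists_of_corner_eq_zero hAW (fun n => p n * q)
    (fun n => hI _ (hpI n) q) hs hss
  simp only [star_star] at hd₂ hd₃
  have hTu : ∀ k, T k * (star (v k) * v k) = star (v k) * v k := fun k => by
    rw [← mul_assoc, (hTp k).mul_star_eq (hvw k).mul_total]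
  have hTv : ∀ k, T k * (v k * star (v k)) = v k * star (v k) := fun k => by
    rw [← mul_assoc, (hvw k).total_mul]
  have hTw' : ∀ k, T k * w k = w k := fun k => by
    have := (hvw k).symm.total_mul
    rwa [(hvw k).total_symm] at this
  have hTw : ∀ k, T k * (w k * star (w k)) = w k * star (w k) := fun k => by
    rw [← mul_assoc, hTw']
  have huT : ∀ k, (star (v k) * v k) * T k = star (v k) * v k := fun k => by
    rw [mul_assoc, (hvw k).mul_total]
  have hvT : ∀ k, (v k * star (v k)) * T k = v k * star (v k) := fun k => by
    rw [mul_assoc, (hTp k).star_mul_eq (hvw k).total_mul]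
  have hwT : ∀ k, (w k * star (w k)) * T k = w k * star (w k) := fun k => by
    rw [mul_assoc, (hTp k).star_mul_eq (hTw' k)]
  have horth : ∀ i j x y, i ≠ j → x * T i = x → T j * y = y → x * y = 0 :=
    fun i j x y hij hx hy => by
      rw [← hx, ← hy, mul_assoc, ← mul_assoc _ _ y, hTT i j hij, zero_mul, mul_zero]
  have haF : ∀ k, (star (z k) * z k) * F k = star (z k) * z k := fun k => by
    rw [mul_assoc, (hpair k).mul_total]
  have hbF : ∀ k, (z k * star (z k)) * F k = z k * star (z k) := fun k => by
    rw [mul_assoc, (hFp k).star_mul_eq (hpair k).total_mul]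
  have hFb : ∀ k, F k * (z k * star (z k)) = z k * star (z k) := fun k => by
    rw [← mul_assoc, (hpair k).total_mul]
  obtain ⟨c, hc⟩ : IsImplementedOn f ((((Set.range fun k => star (v k) * v k) ∪
      (Set.range fun k => v k * star (v k)) ∪ (Set.range fun k => w k * star (w k))) ∪
      ((Set.range fun k => star (z k) * z k) ∪ (Set.range fun k => z k * star (z k)))) ∪
      Set.range fun n => p n * q) := by
    refine .union hAW (.union hAW (.union hAW (.union hAW ?_ ?_ ?_ ?_) ?_ ?_ ?_)
      (.union hAW ?_ ?_ ?_ ?_) ?_ ?_) ?_ ?_ ?_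
    · exact ⟨d₁, by rintro _ ⟨k, rfl⟩; exact hd₁ k⟩
    · exact ⟨d₂, by rintro _ ⟨k, rfl⟩; exact hd₂ k⟩
    · rintro _ ⟨k, rfl⟩; exact (hx k).2.1.1
    · rintro _ ⟨k, rfl⟩ _ ⟨l, rfl⟩
      by_cases hkl : k = l
      · subst hkl
        simp only
        rw [mul_assoc, ← mul_assoc (v k), (hvw k).mul_self, zero_mul, mul_zero]
      · exact horth k l _ _ hkl (huT k) (hTv l)
    · exact ⟨d₃, by rintro _ ⟨k, rfl⟩; exact hd₃ k⟩
    · rintro _ (⟨k, rfl⟩ | ⟨k, rfl⟩)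
      · exact (hx k).2.1.1
      · exact (hx k).2.2.1.1
    · rintro _ (⟨k, rfl⟩ | ⟨k, rfl⟩) _ ⟨l, rfl⟩
      · by_cases hkl : k = l
        · subst hkl
          simp only
          rw [mul_assoc, ← mul_assoc (v k), (hvw k).mul_eq, zero_mul, mul_zero]
        · exact horth k l _ _ hkl (huT k) (hTw l)
      · by_cases hkl : k = l
        · subst hkl
          simp only
          rw [mul_assoc, ← mul_assoc (star (v k)), (hvw k).star_mul_eq, zero_mul, mul_zero]
        · exact horth k l _ _ hkl (hvT k) (hTw l)
    · exact ⟨d₄, by rintro _ ⟨k, rfl⟩; exact hd₄ k⟩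
    · exact ⟨d₅, by rintro _ ⟨k, rfl⟩; exact hd₅ k⟩
    · rintro _ ⟨k, rfl⟩; exact (hz k).2.1.1
    · rintro _ ⟨k, rfl⟩ _ ⟨l, rfl⟩
      by_cases hkl : k = l
      · subst hkl
        simp only
        rw [mul_assoc, ← mul_assoc (z k), (hpair k).mul_self, zero_mul, mul_zero]
      · simp only
        rw [← haF, ← hFb, mul_assoc, ← mul_assoc (F k), show F k * F l = 0 from hzz k l hkl,
          zero_mul, mul_zero]
    · rintro _ ((⟨k, rfl⟩ | ⟨k, rfl⟩) | ⟨k, rfl⟩)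
      · exact (hx k).2.1.1
      · exact (hx k).2.2.1.1
      · exact (hx k).2.2.2.1
    · intro s hs t ht
      obtain ⟨k, hk⟩ : ∃ k, s * T k = s := by
        rcases hs with (⟨k, rfl⟩ | ⟨k, rfl⟩) | ⟨k, rfl⟩
        exacts [⟨k, huT k⟩, ⟨k, hvT k⟩, ⟨k, hwT k⟩]
      rw [← hk, mul_assoc]
      rcases ht with ⟨l, rfl⟩ | ⟨l, rfl⟩
      · simp only [← mul_assoc (T k), hTzs, zero_mul, mul_zero]
      · simp only [← mul_assoc (T k), hTz, zero_mul, mul_zero]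
    · exact ⟨d₆, by rintro _ ⟨k, rfl⟩; exact hd₆ k⟩
    · rintro _ (((⟨k, rfl⟩ | ⟨k, rfl⟩) | ⟨k, rfl⟩) | (⟨k, rfl⟩ | ⟨k, rfl⟩))
      · exact (hx k).2.1.1
      · exact (hx k).2.2.1.1
      · exact (hx k).2.2.2.1
      · exact (hz k).2.1.1
      · exact (hz k).2.2.1.1
    · have hTs' : ∀ k n, T k * (p n * q) = 0 := fun k n => by
        rw [hpq, ← mul_assoc, hTq, zero_mul]
      have hFs' : ∀ k n, F k * (p n * q) = 0 := fun k n => by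
        rw [hpq, ← mul_assoc, hFq, zero_mul]
      rintro _ (((⟨k, rfl⟩ | ⟨k, rfl⟩) | ⟨k, rfl⟩) | (⟨k, rfl⟩ | ⟨k, rfl⟩)) _ ⟨n, rfl⟩
      · simp only; rw [← huT, mul_assoc, hTs', mul_zero]
      · simp only; rw [← hvT, mul_assoc, hTs', mul_zero]
      · simp only; rw [← hwT, mul_assoc, hTs', mul_zero]
      · simp only; rw [← haF, mul_assoc, hFs', mul_zero]
      · simp only; rw [← hbF, mul_assoc, hFs', mul_zero]
  refine ⟨c, fun m => ?_⟩
  set y := c * p m - f (p m) with hy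
  have hy0 : ∀ u, IsPiece p u → c * u = f u → y * u = 0 := fun u hu hcu =>
    hu.map_sub_mul_eq_zero hpp hf hpI hcu m
  have hyT : ∀ k, y * T k = 0 := fun k => by
    simp only [T, IsTriple.total, mul_add]
    rw [hy0 _ (hx k).2.1 (hc _ (.inl (.inl (.inl (.inl ⟨k, rfl⟩))))),
      hy0 _ (hx k).2.2.1 (hc _ (.inl (.inl (.inl (.inr ⟨k, rfl⟩))))),
      hy0 _ (hx k).2.2.2 (hc _ (.inl (.inl (.inr ⟨k, rfl⟩)))), add_zero, add_zero]
  have hyF : ∀ k, y * F k = 0 := fun k => by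
    simp only [F, IsPair.total, mul_add]
    rw [hy0 _ (hz k).2.1 (hc _ (.inl (.inr (.inl ⟨k, rfl⟩)))),
      hy0 _ (hz k).2.2.1 (hc _ (.inl (.inr (.inr ⟨k, rfl⟩)))), add_zero]
  have hyE : y * E = 0 := by
    have := hE2 (star y) (by
      rintro _ ⟨k, rfl⟩; exact mul_eq_zero_of_star (hyT k) rfl (hTs k))
    exact mul_eq_zero_of_star this hE.isSelfAdjoint.star_eq (star_star y)
  have hyG : y * G = 0 := by
    have := hG2 (star y) (by
      rintro _ ⟨k, rfl⟩; exact mul_eq_zero_of_star (hyF k) rfl (hFs k))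
    exact mul_eq_zero_of_star this hG.isSelfAdjoint.star_eq (star_star y)
  have hyq : y * q = y := by
    rw [hq, mul_sub, mul_sub, mul_one, hyE, hyG, sub_zero, sub_zero]
  have hys : y * (p m * q) = 0 := hy0 _ ⟨hs m, m, hps m⟩ (hc _ (.inr ⟨m, rfl⟩))
  have hyp : y * p m = y := by
    rw [hy, sub_mul, mul_assoc, (hp m).isIdempotentElem.eq, hf.map_mul_self (hpI m) (hp m)]
  rw [← sub_eq_zero, ← hy, ← hyq, ← hyp, mul_assoc, hys]

theorem IsBoundedModuleMap.exists_of_isSelfAdjoint {I : Submodule ℂ A} {f : A → A}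
    (hf : IsBoundedModuleMap I f) (hAW : IsAWStar A) (hsf : SigmaFiniteAlg A) {h : A}
    (hI : h ∈ I) (hh : IsSelfAdjoint h) : ∃ c : A, f h = c * h := by
  obtain ⟨p, hp, hpp, hmax⟩ := hsf.exists_maximal_orthogonal (X := A) id
    (fun p => IsStarProjection p ∧ p ∈ I ∧ h * p = p * h) (fun p hp => hp.1) 0
    ⟨.zero A, I.zero_mem, by rw [mul_zero, zero_mul]⟩ rfl
  simp only [id] at hpp hmax
  obtain ⟨e, he, he1, he2⟩ := hAW.exists_support (Set.range p)
  have hcomm : h * e = e * h := by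
    refine he.commute_support he1 he2 ?_ ?_
    · rintro _ ⟨n, rfl⟩; exact (hp n).2.2.symm
    · rintro _ ⟨n, rfl⟩; rw [hh.star_eq]; exact (hp n).2.2.symm
  set k := h * (1 - e) with hk
  have hkI : k ∈ I := hf.isRightIdeal _ hI _
  have hek : (1 - e) * h = k := by rw [hk, mul_sub, sub_mul, hcomm, mul_one, one_mul]
  have hks : star k = k := by
    rw [hk, star_mul, he.one_sub.isSelfAdjoint.star_eq, hh.star_eq, hek]
  have hhk : h * k = k * h := by rw [hk, mul_assoc, hek]
  have hpk : ∀ n, p n * k = 0 := fun n => by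
    rw [hk, ← mul_assoc, ← (hp n).2.2, mul_assoc, mul_sub, mul_one, he1 _ ⟨n, rfl⟩, sub_self,
      mul_zero]
  have hk0 : k = 0 := by
    by_contra hne
    obtain ⟨q, b, hq, hq0, -, hb, hbq, hcq⟩ := hAW.exists_spectral_projection k
      (by rwa [Ne, CStarRing.star_mul_self_eq_zero_iff])
    have hqk : q = k * (k * (b * (b * q))) := by
      rw [hb, hks] at hbq
      simpa only [mul_assoc] using hbq.symm
    refine hq0 (hmax q ⟨hq, ?_, hcq h hh ?_⟩ fun n => ?_)
    · rw [hqk]; exact hf.isRightIdeal _ hkI _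
    · rw [hks, ← mul_assoc, hhk, mul_assoc, hhk, ← mul_assoc]
    · rw [hqk, ← mul_assoc, hpk, zero_mul]
  obtain ⟨c, hc⟩ := hf.exists_of_orthogonal_projections hAW hsf p (fun n => (hp n).2.1)
    (fun n => (hp n).1) hpp
  have hhe : h * e = h := by
    rw [hk, mul_sub, mul_one, sub_eq_zero] at hk0; exact hk0.symm
  set z := c * h - f h with hz
  have hzp : ∀ n, z * p n = 0 := fun n => by
    rw [hz, sub_mul, ← hf.map_mul _ hI, mul_assoc, (hp n).2.2, ← mul_assoc, hc,
      hf.map_mul _ (hp n).2.1, sub_self]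
  have hze : z * e = 0 := by
    have := he2 (star z) (by
      rintro _ ⟨n, rfl⟩; exact mul_eq_zero_of_star (hzp n) rfl (hp n).1.isSelfAdjoint.star_eq)
    exact mul_eq_zero_of_star this he.isSelfAdjoint.star_eq (star_star z)
  have hz0 : z * e = z := by
    rw [hz, sub_mul, mul_assoc, ← hf.map_mul _ hI, hhe]
  exact ⟨c, (sub_eq_zero.1 (hz0.symm.trans hze)).symm⟩

theorem exists_norm_sub_mul_mul_sq_le (h x : A) {ε : ℝ} (hε : 0 < ε) :
    ∃ w : A, ‖x - (h * star h + x * star x) * (w * x)‖ ^ 2 ≤ ε := by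
  let _ := CStarAlgebra.spectralOrder A
  have _ := CStarAlgebra.spectralOrderedRing A
  set P := h * star h + x * star x with hP
  have hP0 : 0 ≤ P := add_nonneg (mul_star_self_nonneg h) (mul_star_self_nonneg x)
  have hxP : x * star x ≤ P := le_add_of_nonneg_left (mul_star_self_nonneg h)
  have hsa : IsSelfAdjoint P := .of_nonneg hP0
  have hpos : ∀ t ∈ spectrum ℝ P, 0 ≤ t := fun t ht => spectrum_nonneg_of_nonneg hP0 ht
  have hc1 : ContinuousOn (fun t : ℝ => (t + ε)⁻¹) (spectrum ℝ P) :=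
    ContinuousOn.inv₀ (by fun_prop) fun t ht => by have := hpos t ht; positivity
  have hc2 : ContinuousOn (fun t : ℝ => ε * (t + ε)⁻¹) (spectrum ℝ P) :=
    continuousOn_const.mul hc1
  set v := cfc (fun t : ℝ => ε * (t + ε)⁻¹) P with hv
  have hvs : star v = v := (cfc_predicate (p := IsSelfAdjoint) _ P : IsSelfAdjoint v).star_eq
  refine ⟨cfc (fun t : ℝ => (t + ε)⁻¹) P, ?_⟩
  have h1 : 1 - P * cfc (fun t : ℝ => (t + ε)⁻¹) P = v := by
    conv_lhs => rw [← cfc_const_one ℝ P]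
    nth_rewrite 2 [← cfc_id' ℝ P]
    rw [← cfc_mul _ _ P (by fun_prop) hc1, ← cfc_sub _ _ P (by fun_prop) (by fun_prop)]
    refine cfc_congr fun t ht => ?_
    have : t + ε ≠ 0 := by have := hpos t ht; positivity
    field_simp
    ring
  have h2 : ‖v * P * v‖ ≤ ε := by
    have : v * P * v = cfc (fun t : ℝ => ε * (t + ε)⁻¹ * t * (ε * (t + ε)⁻¹)) P := by
      rw [cfc_mul _ _ P (by fun_prop) hc2, cfc_mul _ _ P hc2 (by fun_prop), cfc_id' ℝ P]
    rw [this]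
    refine norm_cfc_le hε.le fun t ht => ?_
    have h0 := hpos t ht
    have : ε * (t + ε)⁻¹ * t * (ε * (t + ε)⁻¹) = ε * (ε * t / (t + ε) ^ 2) := by
      field_simp
    rw [this, Real.norm_of_nonneg (by positivity)]
    refine mul_le_of_le_one_right hε.le ?_
    rw [div_le_one (by positivity)]
    nlinarith
  rw [← mul_assoc, ← one_sub_mul, h1, sq, ← CStarRing.norm_self_mul_star]
  refine le_trans ?_ h2
  have h3 : v * x * star (v * x) = v * (x * star x) * star v := by
    rw [star_mul]; simp only [mul_assoc]
  rw [h3]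
  refine CStarAlgebra.norm_le_norm_of_nonneg_of_le
    (star_right_conjugate_nonneg (mul_star_self_nonneg x) v) ?_
  simpa only [hvs] using star_right_conjugate_le_conjugate hxP v

theorem IsBoundedModuleMap.eq_mul_of_add_mul_star {I : Submodule ℂ A} {f : A → A}
    (hf : IsBoundedModuleMap I f) {h x c : A} (hh : h ∈ I) (hx : x ∈ I)
    (hc : f (h * star h + x * star x) = c * (h * star h + x * star x)) : f x = c * x := by
  obtain ⟨C, hC0, hC⟩ := hf.bounded
  have hP : h * star h + x * star x ∈ I :=
    I.add_mem (hf.isRightIdeal _ hh _) (hf.isRightIdeal _ hx _)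
  have key : ∀ ε : ℝ, 0 < ε → ‖f x - c * x‖ ≤ (C + ‖c‖) * ε := fun ε hε => by
    obtain ⟨w, hw⟩ := exists_norm_sub_mul_mul_sq_le h x (pow_pos hε 2)
    set P := h * star h + x * star x
    set d := x - P * (w * x) with hd
    have hPw : P * (w * x) ∈ I := hf.isRightIdeal _ hP _
    have hdI : d ∈ I := I.sub_mem hx hPw
    have h1 : f x - c * x = f d - c * d := by
      have : x = d + P * (w * x) := by rw [hd, sub_add_cancel]
      conv_lhs => rw [this]
      rw [hf.map_add _ hdI _ hPw, hf.map_mul _ hP, hc]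
      noncomm_ring
    have h2 : ‖d‖ ≤ ε := by
      rwa [sq_le_sq₀ (norm_nonneg d) hε.le] at hw
    rw [h1]
    calc ‖f d - c * d‖ ≤ ‖f d‖ + ‖c * d‖ := norm_sub_le _ _
      _ ≤ C * ‖d‖ + ‖c‖ * ‖d‖ := add_le_add (hC d hdI) (norm_mul_le _ _)
      _ = (C + ‖c‖) * ‖d‖ := by ring
      _ ≤ (C + ‖c‖) * ε := by gcongr
  have h0 : ‖f x - c * x‖ ≤ 0 := by
    refine le_of_forall_pos_le_add fun δ hδ => ?_
    refine (key (δ / (C + ‖c‖ + 1)) (by positivity)).trans ?_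
    rw [zero_add, mul_div_assoc', div_le_iff₀ (by positivity)]
    nlinarith [norm_nonneg c]
  exact sub_eq_zero.1 (norm_le_zero_iff.1 h0)

theorem eq_zero_of_mul_star_add_mul_star {a b : A} (h : a * star a + b * star b = 0) :
    a = 0 ∧ b = 0 := by
  let _ := CStarAlgebra.spectralOrder A
  have _ := CStarAlgebra.spectralOrderedRing A
  rw [add_eq_zero_iff_of_nonneg (mul_star_self_nonneg a) (mul_star_self_nonneg b)] at h
  exact ⟨CStarRing.mul_star_self_eq_zero_iff a |>.1 h.1,
    CStarRing.mul_star_self_eq_zero_iff b |>.1 h.2⟩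

theorem Submodule.exists_mul_eq_zero_imp {I : Submodule ℂ A} (hI : IsRightIdeal I)
    (hc : IsClosed (I : Set A)) (h : ℕ → A) (hh : ∀ n, h n ∈ I) :
    ∃ k ∈ I, ∀ z : A, z * k = 0 → ∀ n, z * h n = 0 := by
  let _ := CStarAlgebra.spectralOrder A
  have _ := CStarAlgebra.spectralOrderedRing A
  let r : ℕ → ℝ := fun n => (1 / 2) ^ n / (1 + ‖h n * star (h n)‖)
  have hr : ∀ n, 0 < r n := fun n => by positivity
  have hs : Summable fun n => r n • (h n * star (h n)) := by
    refine Summable.of_norm_bounded summable_geometric_two fun n => ?_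
    rw [norm_smul, Real.norm_of_nonneg (hr n).le, div_mul_eq_mul_div,
      div_le_iff₀ (by positivity)]
    gcongr
    linarith
  refine ⟨∑' n, r n • (h n * star (h n)), ?_, fun z hz n => ?_⟩
  · refine hc.mem_of_tendsto hs.hasSum.tendsto_sum_nat (.of_forall fun N => ?_)
    refine I.sum_mem fun n _ => ?_
    rw [← Complex.coe_smul]
    exact I.smul_mem _ (hI _ (hh n) _)
  · have h1 : HasSum (fun n => z * (r n • (h n * star (h n))) * star z) 0 := by
      have := (hs.hasSum.mul_left z).mul_right (star z)
      rwa [hz, zero_mul] at this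
    have h2 : ∀ n, z * (r n • (h n * star (h n))) * star z =
        r n • ((z * h n) * star (z * h n)) := fun n => by
      rw [mul_smul_comm, smul_mul_assoc, star_mul]; simp only [mul_assoc]
    simp only [h2] at h1
    rw [hasSum_zero_iff_of_nonneg fun n => smul_nonneg (hr n).le (mul_star_self_nonneg _)] at h1
    have := congrFun h1 n
    rw [Pi.zero_apply, smul_eq_zero_iff_right (hr n).ne',
      CStarRing.mul_star_self_eq_zero_iff] at this
    exact this

theorem IsAWStar.exists_left_support (hAW : IsAWStar A) (h : A) :
    ∃ e : A, IsStarProjection e ∧ e * h = h ∧ ∀ z : A, z * h = 0 → z * e = 0 := by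
  obtain ⟨e, he, he1, he2⟩ := hAW.exists_support {star h}
  refine ⟨e, he, ?_, fun z hz => ?_⟩
  · simpa only [star_star] using he.mul_star_eq (he1 _ rfl)
  · have := he2 (star z) (by rintro _ rfl; exact mul_eq_zero_of_star hz rfl rfl)
    exact mul_eq_zero_of_star this he.isSelfAdjoint.star_eq (star_star z)

theorem IsAWStar.exists_forall_mul_eq_zero (hAW : IsAWStar A) (hsf : SigmaFiniteAlg A)
    {I : Submodule ℂ A} (hI : IsRightIdeal I) (hc : IsClosed (I : Set A)) :
    ∃ h ∈ I, ∀ z : A, z * h = 0 → ∀ x ∈ I, z * x = 0 := by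
  obtain ⟨p, hp, hpp, hmax⟩ := hsf.exists_maximal_orthogonal (X := A) id
    (fun p => IsStarProjection p ∧ ∃ h ∈ I, ∀ z : A, z * h = 0 → z * p = 0) (fun p hp => hp.1) 0
    ⟨.zero A, 0, I.zero_mem, fun z hz => hz⟩ rfl
  simp only [id] at hpp hmax
  choose hps h hhI hh using hp
  obtain ⟨k, hkI, hk⟩ := I.exists_mul_eq_zero_imp hI hc h hhI
  refine ⟨k, hkI, fun z hz x hx => ?_⟩
  set P := k * star k + x * star x with hP
  have hPI : P ∈ I := I.add_mem (hI _ hkI _) (hI _ hx _)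
  have hPz : ∀ z : A, z * P = 0 → z * k = 0 ∧ z * x = 0 := fun z hz => by
    refine eq_zero_of_mul_star_add_mul_star ?_
    have := congrArg (· * star z) hz
    simpa only [hP, star_mul, mul_add, add_mul, zero_mul, mul_assoc] using this
  obtain ⟨e, he, hek, hez⟩ := hAW.exists_left_support k
  obtain ⟨e', he', he'P, hez'⟩ := hAW.exists_left_support P
  have hee' : e' * e = e := by
    have := hez (1 - e') (hPz _ (by rw [sub_mul, he'P, one_mul, sub_self])).1
    rw [sub_mul, one_mul, sub_eq_zero] at this
    exact this.symm
  have he'e : e * e' = e := by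
    simpa only [he.isSelfAdjoint.star_eq] using he'.star_mul_eq hee'
  have hd : e' - e = 0 := by
    refine hmax _ ⟨⟨?_, he'.isSelfAdjoint.sub he.isSelfAdjoint⟩, P, hPI, fun z hz => ?_⟩ fun n => ?_
    · simp only [IsIdempotentElem, sub_mul, mul_sub, he'.isIdempotentElem.eq,
        he.isIdempotentElem.eq, hee', he'e]
      abel
    · rw [mul_sub, hez' z hz, hez z (hPz z hz).1, sub_zero]
    · have h1 : p n * e = p n := by
        have := hh n (1 - e) (hk _ (by rw [sub_mul, hek, one_mul, sub_self]) n)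
        rw [sub_mul, one_mul, sub_eq_zero] at this
        simpa only [(hps n).isSelfAdjoint.star_eq] using he.star_mul_eq this.symm
      rw [mul_sub, h1]
      nth_rewrite 1 [← h1]
      rw [mul_assoc, he'e, h1, sub_self]
  have h3 : z * P = 0 := by rw [← he'P, sub_eq_zero.1 hd, ← mul_assoc, hez z hz, zero_mul]
  exact (hPz z h3).2

theorem stmt10 (hAW : IsAWStar A) (hsf : SigmaFiniteAlg A)
    (I : Submodule ℂ A) (hIr : IsRightIdeal I) (hIc : IsClosed (I : Set A))
    (f : A → A)
    (hadd : ∀ x ∈ I, ∀ y ∈ I, f (x + y) = f x + f y)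
    (hsmul : ∀ c : ℂ, ∀ x ∈ I, f (c • x) = c • f x)
    (hmod : ∀ x ∈ I, ∀ r : A, f (x * r) = f x * r)
    (hbdd : ∃ C : ℝ, ∀ x ∈ I, ‖f x‖ ≤ C * ‖x‖) :
    ∃ c : A, ∀ x ∈ I, f x = c * x := by
  obtain ⟨C, hC⟩ := hbdd
  have hf : IsBoundedModuleMap I f := ⟨hIr, hadd, hmod, |C|, abs_nonneg C, fun x hx =>
    (hC x hx).trans (mul_le_mul_of_nonneg_right (le_abs_self C) (norm_nonneg x))⟩
  obtain ⟨h, hh, hz⟩ := hAW.exists_forall_mul_eq_zero hsf hIr hIc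
  have key : ∀ x ∈ I, ∃ c : A, f h = c * h ∧ f x = c * x := fun x hx => by
    obtain ⟨c, hc⟩ := hf.exists_of_isSelfAdjoint hAW hsf
      (I.add_mem (hIr _ hh (star h)) (hIr _ hx (star x)))
      ((IsSelfAdjoint.mul_star_self h).add (.mul_star_self x))
    refine ⟨c, hf.eq_mul_of_add_mul_star hx hh ?_, hf.eq_mul_of_add_mul_star hh hx hc⟩
    rwa [add_comm (x * star x)]
  obtain ⟨c, hc, -⟩ := key h hh
  refine ⟨c, fun x hx => ?_⟩
  obtain ⟨c', hc', hx'⟩ := key x hx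
  have := hz (c' - c) (by rw [sub_mul, ← hc', ← hc, sub_self]) x hx
  rw [hx', ← sub_eq_zero, ← sub_mul, this]
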